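/- arXiv:1902.04847 — 4 statements merged into one kernel-verified Lean document; each statement's English description precedes it below -/
import Mathlib

section
/- For n = 5, GKdim E = 1; equivalently, the pertinency p(A, C₅) = 5 − GKdim E equals 4. -/
open scoped BigOperators

namespace NCIS

variable (k : Type*) [Field k] (n : ℕ)

/-- Relations defining the skew group algebra `A # C_n`, where
`A = k_{-1}[x_0, …, x_{n-1}]`: the generators are `x_i` (`Sum.inl i`) and `s` (`Sum.inr ()`),
subject to `x_i x_j + x_j x_i = 0` for `i ≠ j`, `s^n = 1` and `s x_i = x_{i+1} s`. -/
inductive SGRel : FreeAlgebra k (ZMod n ⊕ Unit) → FreeAlgebra k (ZMod n ⊕ Unit) → Prop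
  | anti (i j : ZMod n) (h : i ≠ j) :
      SGRel (FreeAlgebra.ι k (Sum.inl i) * FreeAlgebra.ι k (Sum.inl j)
           + FreeAlgebra.ι k (Sum.inl j) * FreeAlgebra.ι k (Sum.inl i)) 0
  | spow : SGRel (FreeAlgebra.ι k (Sum.inr ()) ^ n) 1
  | scomm (i : ZMod n) :
      SGRel (FreeAlgebra.ι k (Sum.inr ()) * FreeAlgebra.ι k (Sum.inl i))
            (FreeAlgebra.ι k (Sum.inl (i + 1)) * FreeAlgebra.ι k (Sum.inr ()))

/-- The skew group algebra `A # C_n`. -/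
abbrev SkewGroup := RingQuot (SGRel k n)

/-- The image of the generator `x_i` in `A # C_n`. -/
noncomputable def xg (i : ZMod n) : SkewGroup k n :=
  RingQuot.mkAlgHom k (SGRel k n) (FreeAlgebra.ι k (Sum.inl i))

/-- The image of the generator `s` in `A # C_n`. -/
noncomputable def sg : SkewGroup k n :=
  RingQuot.mkAlgHom k (SGRel k n) (FreeAlgebra.ι k (Sum.inr ()))

/-- The integral `e₀ = (1/n) ∑_{i=0}^{n-1} s^i` in `A # C_n`. -/
noncomputable def e0 : SkewGroup k n := (n : k)⁻¹ • ∑ i ∈ Finset.range n, sg k n ^ i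

/-- The quotient algebra `E = (A # C_n)/(e₀)` of `A # C_n` by the two-sided ideal
generated by `e₀`. -/
abbrev Equot := RingQuot (fun a b : SkewGroup k n => a = e0 k n ∧ b = 0)

end NCIS

namespace NCIS

variable (k : Type*) [Field k] (n : ℕ)

/-- The Gelfand–Kirillov dimension of an algebra `B` with respect to a generating
subspace `V ∋ 1`:  `limsup_{m → ∞} log(dim_k V^m) / log m`, where `V^m` is the span of
all products of `m` elements of `V` (which, since `1 ∈ V`, is the span of all products of
at most `m` elements of `V`). -/
noncomputable def gkdim (B : Type*) [Ring B] [Algebra k B] (V : Submodule k B) : ℝ :=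
  Filter.limsup
    (fun m : ℕ => Real.log (Module.finrank k (V ^ m : Submodule k B)) / Real.log m)
    Filter.atTop

/-- The standard generating subspace of `E = (A#C_n)/(e₀)`: the span of `1` and of the
images of `x_0, …, x_{n-1}` and `s`. -/
noncomputable def Vgen : Submodule k (Equot k n) :=
  Submodule.span k
    (insert (1 : Equot k n)
      (insert (RingQuot.mkAlgHom k (fun a b : SkewGroup k n => a = e0 k n ∧ b = 0) (sg k n))
        (Set.range (fun i : ZMod n =>
          RingQuot.mkAlgHom k (fun a b : SkewGroup k n => a = e0 k n ∧ b = 0) (xg k n i)))))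

end NCIS

namespace NCIS

section Upper

open Submodule

variable {k B : Type*} [Field k] [Ring B] [Algebra k B]

theorem commute_span_of_forall {S T : Set B} (h : ∀ a ∈ S, ∀ b ∈ T, Commute a b) :
    Commute (span k S) (span k T) := by
  rw [commute_iff_eq, span_mul_span, span_mul_span, ← Set.image2_mul, ← Set.image2_mul,
    Set.image2_swap]
  congr 1
  exact Set.image2_congr fun b hb a ha => h a ha b hb

/-- If the span of `1` and a central element `t` absorbs left multiplication of `V` on a
finite-dimensional `F` containing `1`, then the powers of `V` grow at most linearly. -/
theorem finrank_pow_le_of_mul_le {V F : Submodule k B} {t : B} (ht : ∀ b, Commute t b)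
    (hF : F.FG) (h1 : (1 : B) ∈ F) (hVF : V * F ≤ span k {1, t} * F) (m : ℕ) :
    Module.finrank k (V ^ m : Submodule k B) ≤ (m + 1) * Module.finrank k F := by
  have hT : ∀ W : Submodule k B, Commute (span k {1, t}) W := by
    intro W
    rw [← span_eq W]
    refine commute_span_of_forall ?_
    rintro _ (rfl | rfl) b _
    exacts [Commute.one_left b, ht b]
  have hpow : ∀ m : ℕ, V ^ m * F ≤ span k {1, t} ^ m * F := by
    intro m
    induction m with
    | zero => simp
    | succ m ih =>
      calc V ^ (m + 1) * F = V ^ m * (V * F) := by rw [pow_succ, mul_assoc]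
        _ ≤ V ^ m * (span k {1, t} * F) := by gcongr
        _ = span k {1, t} * (V ^ m * F) := by
          rw [← mul_assoc, ← (hT (V ^ m)).eq, mul_assoc]
        _ ≤ span k {1, t} * (span k {1, t} ^ m * F) := by gcongr
        _ = span k {1, t} ^ (m + 1) * F := by rw [pow_succ', mul_assoc]
  have hTm : ∀ m : ℕ,
      span k {1, t} ^ m ≤ span k (Set.range fun c : Fin (m + 1) => t ^ (c : ℕ)) := by
    intro m
    induction m with
    | zero => simp [Submodule.one_eq_span]
    | succ m ih =>
      rw [pow_succ]
      refine (mul_le_mul' ih le_rfl).trans ?_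
      rw [span_mul_span, span_le]
      rintro _ ⟨_, ⟨c, rfl⟩, b, hb, rfl⟩
      apply subset_span
      rcases hb with rfl | rfl
      · exact ⟨c.castSucc, by simp⟩
      · exact ⟨c.succ, by simp [pow_succ]⟩
  have hle : V ^ m ≤ span k (Set.range fun c : Fin (m + 1) => t ^ (c : ℕ)) * F :=
    calc V ^ m = V ^ m * 1 := (mul_one _).symm
      _ ≤ V ^ m * F := by gcongr; exact Submodule.one_le.2 h1
      _ ≤ _ := (hpow m).trans (by gcongr; exact hTm m)
  have : Module.Finite k F := Module.Finite.iff_fg.2 hF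
  have hfin : FiniteDimensional k
      (span k (Set.range fun c : Fin (m + 1) => t ^ (c : ℕ)) : Submodule k B) :=
    FiniteDimensional.span_of_finite k (Set.finite_range _)
  have : Module.Finite k
      (span k (Set.range fun c : Fin (m + 1) => t ^ (c : ℕ)) * F : Submodule k B) :=
    Module.Finite.iff_fg.2 ((Module.Finite.iff_fg.1 hfin).mul hF)
  refine (finrank_mono hle).trans ?_
  rw [← mulMap_range]
  refine (LinearMap.finrank_range_le _).trans ?_
  rw [Module.finrank_tensorProduct]
  gcongr
  simpa [Set.finrank] using finrank_range_le_card (R := k) fun c : Fin (m + 1) => t ^ (c : ℕ)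

variable {x : ZMod 5 → B} {s : B}

theorem commute_sq_of_anticomm (hx : ∀ i j, i ≠ j → x i * x j + x j * x i = 0) (i j : ZMod 5) :
    Commute (x i ^ 2) (x j) := by
  rcases eq_or_ne i j with rfl | h
  · exact (Commute.refl _).pow_left 2
  · have h' := eq_neg_of_add_eq_zero_left (hx i j h)
    rw [commute_iff_eq, pow_two, mul_assoc, h', mul_neg, ← mul_assoc, h', neg_mul, neg_neg,
      mul_assoc]

theorem pow_mul_sq (hs : ∀ i, s * x i = x (i + 1) * s) (j : ℕ) (i : ZMod 5) :
    s ^ j * x i ^ 2 = x (i + j) ^ 2 * s ^ j := by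
  induction j with
  | zero => simp
  | succ j ih =>
    have h (i : ZMod 5) : s * x i ^ 2 = x (i + 1) ^ 2 * s := by
      rw [pow_two, ← mul_assoc, hs, mul_assoc, hs, ← mul_assoc, pow_two]
    rw [pow_succ', mul_assoc, ih, ← mul_assoc, h, mul_assoc]
    push_cast
    rw [add_assoc]

/-- A relation `∑ cᵢ sⁱ = 0` whose coefficients commute with the squares `x_a²` can be multiplied
coefficientwise by the differences `x_a² - x_{a+j+i}²`. -/
theorem sum_sub_mul_eq_zero (hs : ∀ i, s * x i = x (i + 1) * s) {c : ℕ → B}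
    (hc : ∀ i a, Commute (c i) (x a ^ 2)) (h : ∑ i ∈ Finset.range 5, c i * s ^ i = 0)
    (a j : ZMod 5) :
    ∑ i ∈ Finset.range 5, (x a ^ 2 - x (a + j + i) ^ 2) * c i * s ^ i = 0 := by
  have : ∑ i ∈ Finset.range 5, (x a ^ 2 - x (a + j + i) ^ 2) * c i * s ^ i =
      x a ^ 2 * ∑ i ∈ Finset.range 5, c i * s ^ i -
        (∑ i ∈ Finset.range 5, c i * s ^ i) * x (a + j) ^ 2 := by
    rw [Finset.mul_sum, Finset.sum_mul, ← Finset.sum_sub_distrib]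
    refine Finset.sum_congr rfl fun i _ => ?_
    rw [sub_mul, sub_mul, mul_assoc, mul_assoc (c i), pow_mul_sq hs, ← mul_assoc (c i),
      (hc i _).eq]
  rw [this, h, mul_zero, zero_mul, sub_zero]

theorem prod_sub_eq_zero (hx : ∀ i j, i ≠ j → x i * x j + x j * x i = 0)
    (hs : ∀ i, s * x i = x (i + 1) * s) (h : ∑ i ∈ Finset.range 5, s ^ i = 0)
    (a b c d : ZMod 5) :
    (x a ^ 2 - x (a + 1) ^ 2) * (x b ^ 2 - x (b + 2) ^ 2) * (x c ^ 2 - x (c + 3) ^ 2) *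
      (x d ^ 2 - x (d + 4) ^ 2) = 0 := by
  have hy (i j : ZMod 5) : Commute (x i ^ 2) (x j ^ 2) := (commute_sq_of_anticomm hx i j).pow_right 2
  have hsub (i j l : ZMod 5) : Commute (x i ^ 2 - x j ^ 2) (x l ^ 2) := (hy i l).sub_left (hy j l)
  have h4 := sum_sub_mul_eq_zero hs (c := fun _ => 1) (fun _ _ => Commute.one_left _)
    (by simpa using h) d 4
  have h3 := sum_sub_mul_eq_zero hs (fun _ _ => (hsub _ _ _).mul_left (Commute.one_left _)) h4 c 3
  have h2 := sum_sub_mul_eq_zero hs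
    (fun _ _ => (hsub _ _ _).mul_left ((hsub _ _ _).mul_left (Commute.one_left _))) h3 b 2
  have h1 := sum_sub_mul_eq_zero hs (fun _ _ => (hsub _ _ _).mul_left
    ((hsub _ _ _).mul_left ((hsub _ _ _).mul_left (Commute.one_left _)))) h2 a 1
  have e1 : ∀ a : ZMod 5, a + 4 + 1 = a := by decide
  have e2 : ∀ a : ZMod 5, a + 3 + 2 = a := by decide
  have e3 : ∀ a : ZMod 5, a + 2 + 3 = a := by decide
  have e4 : ∀ a : ZMod 5, a + 1 + 4 = a := by decide
  simpa [Finset.sum_range_succ, e1, e2, e3, e4, mul_assoc] using h1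

/-- The deviation of the square `xᵢ²` from the mean of all the squares. -/
def sqDev (k : Type*) {B : Type*} [Field k] [Ring B] [Algebra k B] (x : ZMod 5 → B) (i : ZMod 5) :
    B :=
  x i ^ 2 - (5 : k)⁻¹ • ∑ j, x j ^ 2

theorem sqDev_mem [CharZero k] (j : ZMod 5) (hj : j ≠ 0) (i : ZMod 5) :
    sqDev k x i ∈ span k (Set.range fun a => x a ^ 2 - x (a + j) ^ 2) := by
  set D := span k (Set.range fun a => x a ^ 2 - x (a + j) ^ 2) with hD
  have hmul (a : ZMod 5) (m : ℕ) : x a ^ 2 - x (a + m * j) ^ 2 ∈ D := by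
    induction m with
    | zero => simp
    | succ m ih =>
      have h : x (a + m * j) ^ 2 - x (a + m * j + j) ^ 2 ∈ D := subset_span ⟨_, rfl⟩
      have := D.add_mem ih h
      rw [sub_add_sub_cancel] at this
      convert this using 4
      push_cast
      ring
  have hsub (a b : ZMod 5) : x a ^ 2 - x b ^ 2 ∈ D := by
    have : Fact (Nat.Prime 5) := ⟨by norm_num⟩
    have := hmul a ((b - a) / j).val
    rwa [ZMod.natCast_val, ZMod.cast_id, div_mul_cancel₀ _ hj, add_sub_cancel] at this
  have : sqDev k x i = (5 : k)⁻¹ • ∑ b, (x i ^ 2 - x b ^ 2) := by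
    rw [sqDev, Finset.sum_sub_distrib, smul_sub, Finset.sum_const, Finset.card_univ, ZMod.card,
      ← Nat.cast_smul_eq_nsmul k, smul_smul, Nat.cast_ofNat,
      inv_mul_cancel₀ (by norm_num : (5 : k) ≠ 0), one_smul]
  rw [this]
  exact D.smul_mem _ (D.sum_mem fun b _ => hsub i b)

theorem span_sqDev_pow_four [CharZero k] (hx : ∀ i j, i ≠ j → x i * x j + x j * x i = 0)
    (hs : ∀ i, s * x i = x (i + 1) * s) (h : ∑ i ∈ Finset.range 5, s ^ i = 0) :
    span k (Set.range (sqDev k x)) ^ 4 = ⊥ := by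
  have hle (j : ZMod 5) (hj : j ≠ 0) : span k (Set.range (sqDev k x)) ≤
      span k (Set.range fun a => x a ^ 2 - x (a + j) ^ 2) := by
    rw [span_le]
    rintro _ ⟨i, rfl⟩
    exact sqDev_mem j hj i
  rw [eq_bot_iff, show (4 : ℕ) = 0 + 1 + 1 + 1 + 1 from rfl, pow_succ, pow_succ, pow_succ, pow_succ,
    pow_zero, one_mul]
  refine (mul_le_mul' (mul_le_mul' (mul_le_mul' (hle 1 (by decide)) (hle 2 (by decide)))
    (hle 3 (by decide))) (hle 4 (by decide))).trans ?_
  simp only [span_mul_span]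
  rw [span_le]
  rintro _ ⟨_, ⟨_, ⟨_, ⟨a, rfl⟩, _, ⟨b, rfl⟩, rfl⟩, _, ⟨c, rfl⟩, rfl⟩, _, ⟨d, rfl⟩, rfl⟩
  exact prod_sub_eq_zero hx hs h a b c d

/-- The span of `1` and `xᵢ`. -/
def lineSpan (k : Type*) {B : Type*} [Field k] [Ring B] [Algebra k B] (x : ZMod 5 → B)
    (i : ZMod 5) : Submodule k B :=
  span k {1, x i}

theorem commute_span_singleton_lineSpan (hx : ∀ i j, i ≠ j → x i * x j + x j * x i = 0)
    (i j : ZMod 5) : Commute (span k {x j}) (lineSpan k x i) := by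
  rcases eq_or_ne i j with rfl | hij
  · exact commute_span_of_forall (by simp)
  · have h := eq_neg_of_add_eq_zero_left (hx j i hij.symm)
    rw [commute_iff_eq, lineSpan, span_mul_span, span_mul_span, Set.singleton_mul,
      Set.mul_singleton, Set.image_pair, Set.image_pair, h, mul_one, one_mul, span_insert,
      span_insert, ← Set.neg_singleton, span_neg]

theorem commute_lineSpan (hx : ∀ i j, i ≠ j → x i * x j + x j * x i = 0) (i j : ZMod 5) :
    Commute (lineSpan k x j) (lineSpan k x i) := by
  rw [lineSpan, span_insert, ← Submodule.one_eq_span, ← Submodule.add_eq_sup]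
  exact (Commute.one_left _).add_left (commute_span_singleton_lineSpan hx i j)

theorem span_singleton_mul_lineSpan (hs : ∀ i, s * x i = x (i + 1) * s) (i : ZMod 5) :
    span k {s} * lineSpan k x i = lineSpan k x (i + 1) * span k {s} := by
  rw [lineSpan, lineSpan, span_mul_span, span_mul_span, Set.singleton_mul, Set.mul_singleton,
    Set.image_pair, Set.image_pair, hs, mul_one, one_mul]

theorem commute_sqDev (hx : ∀ i j, i ≠ j → x i * x j + x j * x i = 0) (i j : ZMod 5) :
    Commute (sqDev k x i) (x j) :=
  (commute_sq_of_anticomm hx i j).sub_left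
    ((Commute.sum_left _ _ _ fun l _ => commute_sq_of_anticomm hx l j).smul_left _)

theorem commute_span_sqDev_lineSpan (hx : ∀ i j, i ≠ j → x i * x j + x j * x i = 0) (i : ZMod 5) :
    Commute (span k (Set.range (sqDev k x))) (lineSpan k x i) := by
  refine commute_span_of_forall ?_
  rintro _ ⟨j, rfl⟩ _ (rfl | rfl)
  exacts [Commute.one_right _, commute_sqDev hx j i]

theorem commute_sum_sq (hs : ∀ i, s * x i = x (i + 1) * s) : Commute (∑ j, x j ^ 2) s := by
  have h (i : ZMod 5) : s * x i ^ 2 = x (i + 1) ^ 2 * s := by simpa using pow_mul_sq hs 1 i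
  rw [commute_iff_eq, Finset.mul_sum, Finset.sum_mul]
  simp_rw [h]
  exact (Equiv.sum_comp (Equiv.addRight (1 : ZMod 5)) fun i => x i ^ 2 * s).symm

theorem mul_sqDev (hs : ∀ i, s * x i = x (i + 1) * s) (i : ZMod 5) :
    s * sqDev k x i = sqDev k x (i + 1) * s := by
  have h : s * x i ^ 2 = x (i + 1) ^ 2 * s := by simpa using pow_mul_sq hs 1 i
  rw [sqDev, sqDev, mul_sub, sub_mul, h, mul_smul_comm, smul_mul_assoc, (commute_sum_sq hs).eq]

theorem commute_span_sqDev_span_singleton (hs : ∀ i, s * x i = x (i + 1) * s) :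
    Commute (span k {s}) (span k (Set.range (sqDev k x))) := by
  rw [commute_iff_eq, span_mul_span, span_mul_span, Set.singleton_mul, Set.mul_singleton,
    ← Set.range_comp, ← Set.range_comp]
  congr 1
  rw [← (Equiv.addRight (1 : ZMod 5)).surjective.range_comp ((fun b => b * s) ∘ sqDev k x)]
  congr 1
  funext i
  exact mul_sqDev hs i

theorem span_singleton_mul_lineSpan_self_le (j : ZMod 5) :
    span k {x j} * lineSpan k x j ≤
      span k {1, ∑ j, x j ^ 2} * (lineSpan k x j * (1 + span k (Set.range (sqDev k x)))) := by
  have h1 : (1 : B) ∈ 1 + span k (Set.range (sqDev k x)) :=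
    mem_sup_left (Submodule.one_le.1 le_rfl)
  have hL : (1 : B) ∈ lineSpan k x j := subset_span (by simp)
  have hT : (1 : B) ∈ span k {1, ∑ j, x j ^ 2} := subset_span (by simp)
  rw [lineSpan, span_mul_span, span_le]
  rintro _ ⟨_, rfl, b, rfl | rfl, rfl⟩
  · simpa using mul_mem_mul hT (mul_mem_mul (subset_span (by simp) : x j ∈ lineSpan k x j) h1)
  · have hx2 : x j * x j = (5 : k)⁻¹ • ((∑ j, x j ^ 2) * (1 * 1)) + 1 * (1 * sqDev k x j) := by
      simp [sqDev, pow_two]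
    change x j * x j ∈ _
    rw [hx2]
    refine add_mem (smul_mem _ _ (mul_mem_mul (subset_span (by simp)) (mul_mem_mul hL h1)))
      (mul_mem_mul hT (mul_mem_mul hL (mem_sup_right (subset_span ⟨j, rfl⟩))))

theorem exists_finrank_pow_le [CharZero k] (hx : ∀ i j, i ≠ j → x i * x j + x j * x i = 0)
    (hs : ∀ i, s * x i = x (i + 1) * s) (h5 : s ^ 5 = 1) (h : ∑ i ∈ Finset.range 5, s ^ i = 0)
    (hgen : Algebra.adjoin k (insert s (Set.range x)) = ⊤) :
    ∃ C : ℕ, ∀ m : ℕ, Module.finrank k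
      (span k (insert 1 (insert s (Set.range x))) ^ m : Submodule k B) ≤ (m + 1) * C := by
  set W := span k (Set.range (sqDev k x)) with hW
  set T := span k {1, ∑ j, x j ^ 2} with hTdef
  set L := lineSpan k x with hLdef
  set S := Subalgebra.toSubmodule (Algebra.adjoin k {s}) with hS
  set D : Submodule k B := 1 + W + W ^ 2 + W ^ 3 with hD
  have hcentral : ∀ b, Commute (∑ j, x j ^ 2) b := by
    have hle : Algebra.adjoin k (insert s (Set.range x)) ≤
        Subalgebra.centralizer k {∑ j, x j ^ 2} := by
      rw [Algebra.adjoin_le_iff]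
      rintro _ (rfl | ⟨i, rfl⟩) _ rfl
      · exact commute_sum_sq hs
      · exact Commute.sum_left _ _ _ fun l _ => commute_sq_of_anticomm hx l i
    intro b
    exact (hle (hgen ▸ Algebra.mem_top : b ∈ _)) _ rfl
  have hT1 : 1 ≤ T := Submodule.one_le.2 (subset_span (by simp))
  have hWL (i : ZMod 5) : Commute (1 + W) (L i) :=
    (Commute.one_left _).add_left (commute_span_sqDev_lineSpan hx i)
  have hWD : (1 + W) * D ≤ D := by
    have h4 : W ^ 4 = 0 := span_sqDev_pow_four hx hs h
    have : (1 + W) * D = D + (W + W ^ 2 + W ^ 3 + W ^ 4) := by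
      rw [add_mul, one_mul, hD, mul_add, mul_add, mul_add, mul_one, ← pow_succ', ← pow_succ',
        ← pow_two]
    rw [this, h4, add_zero]
    simp only [hD, Submodule.add_eq_sup]
    refine sup_le le_rfl (sup_le (sup_le ?_ ?_) ?_)
    · exact le_sup_of_le_left (le_sup_of_le_left le_sup_right)
    · exact le_sup_of_le_left le_sup_right
    · exact le_sup_right
  have hsD : span k {s} * D = D * span k {s} := by
    have hc : Commute (span k {s}) W := commute_span_sqDev_span_singleton hs
    exact (((Commute.one_right _).add_right hc).add_right (hc.pow_right 2)).add_right
      (hc.pow_right 3)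
  have hsS : span k {s} * S ≤ S := by
    refine mul_le.2 fun a ha b hb => (Algebra.adjoin k {s}).mul_mem ?_ hb
    exact (span_le (p := S)).2 (by simp [S]) ha
  have hsL (i : ZMod 5) : span k {s} * L i = L (i + 1) * span k {s} :=
    span_singleton_mul_lineSpan hs i
  set R : ZMod 5 → Submodule k B := fun j => L (j + 1) * L (j + 2) * L (j + 3) * L (j + 4) with hR
  have hrot (j : ZMod 5) : L (j + 1) * R (j + 1) = L j * R j := by
    have e : j + 1 + 1 = j + 2 ∧ j + 1 + 2 = j + 3 ∧ j + 1 + 3 = j + 4 ∧ j + 1 + 4 = j := by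
      revert j
      decide
    have hc : Commute (L j) (R j) :=
      (((commute_lineSpan hx _ _).mul_right (commute_lineSpan hx _ _)).mul_right
        (commute_lineSpan hx _ _)).mul_right (commute_lineSpan hx _ _)
    rw [hc.eq]
    simp only [hR, e, mul_assoc]
  set P := L 0 * R 0 with hP
  have hPj (j : ZMod 5) : L j * R j = P := by
    have hm (m : ℕ) : L m * R m = P := by
      induction m with
      | zero => simp [hP]
      | succ m ih => rw [Nat.cast_succ, hrot, ih]
    simpa using hm j.val
  have hxP (j : ZMod 5) : span k {x j} * P ≤ T * (P * (1 + W)) := by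
    have hc : Commute (1 + W) (R j) :=
      (((hWL _).mul_right (hWL _)).mul_right (hWL _)).mul_right (hWL _)
    calc span k {x j} * P = span k {x j} * L j * R j := by rw [← hPj j, mul_assoc]
      _ ≤ T * (L j * (1 + W)) * R j := by gcongr ?_ * R j; exact span_singleton_mul_lineSpan_self_le j
      _ = T * (P * (1 + W)) := by
        rw [mul_assoc, mul_assoc, hc.eq, ← mul_assoc (L j), hPj]
  have hsP : span k {s} * P = P * span k {s} := by
    have e : (0 + 1 + 1 : ZMod 5) = 0 + 1 + 1 ∧ (0 + 2 + 1 : ZMod 5) = 0 + 1 + 2 ∧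
        (0 + 3 + 1 : ZMod 5) = 0 + 1 + 3 ∧ (0 + 4 + 1 : ZMod 5) = 0 + 1 + 4 := by decide
    conv_rhs => rw [← hPj (0 + 1)]
    have hsL' (i : ZMod 5) (U : Submodule k B) :
        span k {s} * (L i * U) = L (i + 1) * (span k {s} * U) := by
      rw [← mul_assoc, hsL, mul_assoc]
    simp only [hP, hR, mul_assoc, hsL, hsL', e.2.1, e.2.2.1, e.2.2.2]
  refine ⟨Module.finrank k (P * D * S : Submodule k B),
    finrank_pow_le_of_mul_le hcentral ?_ ?_ ?_⟩
  · have hL (i : ZMod 5) : (L i).FG := fg_span (by simp)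
    have hWfg : W.FG := fg_span (Set.finite_range _)
    have h1fg : (1 : Submodule k B).FG := Submodule.one_eq_span (R := k) (A := B) ▸ fg_span (by simp)
    have hDfg : D.FG := ((h1fg.sup hWfg).sup (hWfg.pow 2)).sup (hWfg.pow 3)
    have hs' : IsIntegral k s := IsIntegral.of_pow (by norm_num) (h5 ▸ isIntegral_one)
    exact (((hL _).mul ((((hL _).mul (hL _)).mul (hL _)).mul (hL _))).mul hDfg).mul
      hs'.fg_adjoin_singleton
  · have hL (i : ZMod 5) : (1 : B) ∈ L i := subset_span (by simp)
    have hP1 : (1 : B) ∈ P := by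
      simpa [hP, hR] using mul_mem_mul (hL 0)
        (mul_mem_mul (mul_mem_mul (mul_mem_mul (hL (0 + 1)) (hL (0 + 2))) (hL (0 + 3))) (hL (0 + 4)))
    have hD1 : (1 : B) ∈ D :=
      mem_sup_left (mem_sup_left (mem_sup_left (Submodule.one_le.1 le_rfl)))
    simpa using mul_mem_mul (mul_mem_mul hP1 hD1) (one_mem (Algebra.adjoin k {s}))
  · rw [span_insert, span_insert, ← Submodule.one_eq_span, Submodule.sup_mul, Submodule.sup_mul,
      one_mul]
    have hle : P * D * S ≤ T * (P * D * S) := le_mul_of_one_le_left' hT1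
    refine sup_le hle (sup_le ?_ ?_)
    · refine le_trans ?_ hle
      calc span k {s} * (P * D * S) = P * D * (span k {s} * S) := by
            rw [← mul_assoc, ← mul_assoc, hsP, mul_assoc P, hsD]
            simp only [mul_assoc]
        _ ≤ P * D * S := by gcongr
    · rw [span_range_eq_iSup, Submodule.iSup_mul]
      refine iSup_le fun j => ?_
      calc span k {x j} * (P * D * S) = span k {x j} * P * D * S := by simp only [mul_assoc]
        _ ≤ T * (P * (1 + W)) * D * S := by gcongr ?_ * D * S; exact hxP j
        _ = T * (P * ((1 + W) * D) * S) := by simp only [mul_assoc]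
        _ ≤ T * (P * D * S) := by gcongr

end Upper

section Lower

open Matrix

variable {k : Type*} [Field k]

/-- Five anticommuting involutions in `M₄(k)`, for `I` a square root of `-1`. -/
def gammaMat (I : k) : ZMod 5 → Matrix (Fin 4) (Fin 4) k :=
  ![!![1, 0, 0, 0; 0, 1, 0, 0; 0, 0, -1, 0; 0, 0, 0, -1],
    !![0, 0, 1, 0; 0, 0, 0, 1; 1, 0, 0, 0; 0, 1, 0, 0],
    !![0, 0, 0, -I; 0, 0, -I, 0; 0, I, 0, 0; I, 0, 0, 0],
    !![0, 0, 0, -1; 0, 0, 1, 0; 0, 1, 0, 0; -1, 0, 0, 0],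
    !![0, 0, -I, 0; 0, 0, 0, I; I, 0, 0, 0; 0, -I, 0, 0]]

/-- Twice the spin lift of the cyclic permutation of the matrices `gammaMat I`. -/
def spinMat (I : k) : Matrix (Fin 4) (Fin 4) k :=
  !![I, I, 1, -1; I, -I, 1, 1; I, I, -1, 1; I, -I, -1, -1]

theorem gammaMat_anticomm {I : k} (hI : I * I = -1) (i j : ZMod 5) (h : i ≠ j) :
    gammaMat I i * gammaMat I j + gammaMat I j * gammaMat I i = 0 := by
  fin_cases i <;> fin_cases j <;> first | exact absurd rfl h | skip
  all_goals
    rw [add_eq_zero_iff_eq_neg]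
    simp [gammaMat, hI]

theorem spinMat_mul_gammaMat {I : k} (hI : I * I = -1) (i : ZMod 5) :
    spinMat I * gammaMat I i = gammaMat I (i + 1) * spinMat I := by
  have e : (0 + 1 : ZMod 5) = 1 ∧ (1 + 1 : ZMod 5) = 2 ∧ (2 + 1 : ZMod 5) = 3 ∧
    (3 + 1 : ZMod 5) = 4 ∧ (4 + 1 : ZMod 5) = 0 := by decide
  fin_cases i
  · change spinMat I * gammaMat I 0 = gammaMat I (0 + 1) * spinMat I
    rw [e.1]
    simp [gammaMat, spinMat]
  · change spinMat I * gammaMat I 1 = gammaMat I (1 + 1) * spinMat I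
    rw [e.2.1]
    simp [gammaMat, spinMat, hI]
  · change spinMat I * gammaMat I 2 = gammaMat I (2 + 1) * spinMat I
    rw [e.2.2.1]
    simp [gammaMat, spinMat, hI]
  · change spinMat I * gammaMat I 3 = gammaMat I (3 + 1) * spinMat I
    rw [e.2.2.2.1]
    simp [gammaMat, spinMat, hI]
  · change spinMat I * gammaMat I 4 = gammaMat I (4 + 1) * spinMat I
    rw [e.2.2.2.2]
    simp [gammaMat, spinMat, hI]

set_option maxHeartbeats 1000000 in
theorem sum_spinMat_pow {I : k} (hI : I * I = -1) :
    (16 : k) • 1 + (8 : k) • spinMat I + (4 : k) • spinMat I ^ 2 + (2 : k) • spinMat I ^ 3 +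
      spinMat I ^ 4 = 0 := by
  have h2 : spinMat I ^ 2 =
      !![-2, 2 * I, 2 * I, 2; 2 * I, -2, -2, -2 * I; -2, -2 * I, 2 * I, -2;
        -2 * I, -2, 2, -2 * I] := by
    rw [pow_two]
    ext a b
    fin_cases a <;> fin_cases b <;> simp [spinMat, hI] <;> ring
  rw [pow_succ _ 3, pow_succ _ 2, h2, mul_assoc, ← pow_two, h2]
  ext a b
  fin_cases a <;> fin_cases b <;> simp [spinMat] <;> grind

theorem sum_half_spinMat_pow [CharZero k] {I : k} (hI : I * I = -1) :
    ∑ i ∈ Finset.range 5, ((2 : k)⁻¹ • spinMat I) ^ i = 0 := by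
  have h : ∑ i ∈ Finset.range 5, ((2 : k)⁻¹ • spinMat I) ^ i = (16 : k)⁻¹ •
      ((16 : k) • 1 + (8 : k) • spinMat I + (4 : k) • spinMat I ^ 2 + (2 : k) • spinMat I ^ 3 +
        spinMat I ^ 4) := by
    simp only [Finset.sum_range_succ, Finset.sum_range_zero, smul_pow, smul_add, smul_smul]
    norm_num
  rw [h, sum_spinMat_pow hI, smul_zero]

theorem gammaMat_zero_mul_self (I : k) : gammaMat I 0 * gammaMat I 0 = 1 := by
  ext a b
  fin_cases a <;> fin_cases b <;> simp [gammaMat]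

open Polynomial in
/-- The spin representation of `E` on the diagonal line, as a homomorphism to `M₄(k)[X]`. -/
theorem exists_algHom_matrix_polynomial [CharZero k] {I : k} (hI : I * I = -1) :
    ∃ φ : Equot k 5 →ₐ[k] (Matrix (Fin 4) (Fin 4) k)[X], ∀ i,
      φ (RingQuot.mkAlgHom k (fun a b : SkewGroup k 5 => a = e0 k 5 ∧ b = 0) (xg k 5 i)) =
        monomial 1 (gammaMat I i) := by
  set g : Matrix (Fin 4) (Fin 4) k := (2 : k)⁻¹ • spinMat I with hg
  have hsum : ∑ i ∈ Finset.range 5, g ^ i = 0 := sum_half_spinMat_pow hI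
  have hg5 : g ^ 5 = 1 := by
    have := geom_sum_mul g 5
    rw [hsum, zero_mul] at this
    exact (sub_eq_zero.1 this.symm)
  let f : FreeAlgebra k (ZMod 5 ⊕ Unit) →ₐ[k] (Matrix (Fin 4) (Fin 4) k)[X] :=
    FreeAlgebra.lift k (Sum.elim (fun i => monomial 1 (gammaMat I i)) fun _ => C g)
  have hf : ∀ ⦃a b⦄, SGRel k 5 a b → f a = f b := by
    intro a b hab
    induction hab with
    | anti i j h =>
      simp only [f, map_add, map_mul, FreeAlgebra.lift_ι_apply, Sum.elim_inl, monomial_mul_monomial,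
        map_zero]
      rw [← map_add, gammaMat_anticomm hI i j h, map_zero]
    | spow => simp only [f, map_pow, FreeAlgebra.lift_ι_apply, Sum.elim_inr, ← C_pow, hg5, map_one]
    | scomm i =>
      simp only [f, map_mul, FreeAlgebra.lift_ι_apply, Sum.elim_inl, Sum.elim_inr,
        C_mul_monomial, monomial_mul_C, hg, smul_mul_assoc, mul_smul_comm,
        spinMat_mul_gammaMat hI i]
  let f' : SkewGroup k 5 →ₐ[k] (Matrix (Fin 4) (Fin 4) k)[X] := RingQuot.liftAlgHom k ⟨f, hf⟩
  have hs : f' (sg k 5) = C g := by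
    simp only [f', sg, RingQuot.liftAlgHom_mkAlgHom_apply, f, FreeAlgebra.lift_ι_apply,
      Sum.elim_inr]
  have hx (i) : f' (xg k 5 i) = monomial 1 (gammaMat I i) := by
    simp only [f', xg, RingQuot.liftAlgHom_mkAlgHom_apply, f, FreeAlgebra.lift_ι_apply,
      Sum.elim_inl]
  have hf' : ∀ ⦃a b⦄, (a = e0 k 5 ∧ b = 0) → f' a = f' b := by
    rintro _ _ ⟨rfl, rfl⟩
    rw [e0, map_smul, map_sum, map_zero]
    have hC : ∑ i ∈ Finset.range 5, f' (sg k 5 ^ i) = C (∑ i ∈ Finset.range 5, g ^ i) := by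
      simp only [map_sum, map_pow, hs]
    rw [hC, hsum, map_zero, smul_zero]
  refine ⟨RingQuot.liftAlgHom k ⟨f', hf'⟩, fun i => ?_⟩
  rw [RingQuot.liftAlgHom_mkAlgHom_apply, hx]

open Polynomial in
theorem linearIndependent_monomial_pow {M : Type*} [Ring M] [Algebra k M] {u : M}
    (hu : ∀ j : ℕ, u ^ j ≠ 0) : LinearIndependent k fun j : ℕ => monomial j (u ^ j) := by
  rw [linearIndependent_iff']
  intro s c h i hi
  have := congrArg (fun p => coeff p i) h
  simp only [finsetSum_coeff, coeff_smul, coeff_monomial, smul_ite, smul_zero, coeff_zero,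
    Finset.sum_ite_eq', hi, if_true] at this
  exact (smul_eq_zero.1 this).resolve_right (hu i)

theorem succ_le_finrank_Vgen_pow [CharZero k] {I : k} (hI : I * I = -1) (m : ℕ) :
    m + 1 ≤ Module.finrank k (Vgen k 5 ^ m : Submodule k (Equot k 5)) := by
  obtain ⟨φ, hφ⟩ := exists_algHom_matrix_polynomial hI
  set x0 := RingQuot.mkAlgHom k (fun a b : SkewGroup k 5 => a = e0 k 5 ∧ b = 0) (xg k 5 0)
  have hu (j : ℕ) : gammaMat I 0 ^ j ≠ 0 :=
    ((IsUnit.of_mul_eq_one _ (gammaMat_zero_mul_self I)).pow j).ne_zero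
  have hli : LinearIndependent k fun j : ℕ => x0 ^ j := by
    refine LinearIndependent.of_comp φ.toLinearMap ?_
    have hcomp : (φ.toLinearMap ∘ fun j : ℕ => x0 ^ j) =
        fun j : ℕ => Polynomial.monomial j (gammaMat I 0 ^ j) := by
      funext j
      simp [x0, hφ, Polynomial.monomial_pow]
    rw [hcomp]
    exact linearIndependent_monomial_pow hu
  have hmem (j : Fin (m + 1)) : x0 ^ (j : ℕ) ∈ Vgen k 5 ^ m := by
    have h1 : 1 ≤ Vgen k 5 := Submodule.one_le.2 (Submodule.subset_span (by simp))
    exact pow_le_pow_right' h1 (Nat.lt_succ_iff.1 j.2)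
      (Submodule.pow_mem_pow _ (Submodule.subset_span (by simp [x0])) _)
  have hfin : Module.Finite k (Vgen k 5 ^ m : Submodule k (Equot k 5)) :=
    Module.Finite.iff_fg.2 ((Submodule.fg_span (by simp [Set.finite_range])).pow m)
  have hli' : LinearIndependent k
      fun j : Fin (m + 1) => (⟨x0 ^ (j : ℕ), hmem j⟩ : (Vgen k 5 ^ m : Submodule k (Equot k 5))) :=
    LinearIndependent.of_comp (Submodule.subtype _) (hli.comp _ Fin.val_injective)
  simpa using hli'.fintype_card_le_finrank

end Lower

section Main

variable (k : Type*) [Field k]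

theorem exists_finrank_Vgen_pow_le [CharZero k] :
    ∃ C : ℕ, ∀ m : ℕ,
      Module.finrank k (Vgen k 5 ^ m : Submodule k (Equot k 5)) ≤ (m + 1) * C := by
  let q : SkewGroup k 5 →ₐ[k] Equot k 5 :=
    RingQuot.mkAlgHom k (fun a b : SkewGroup k 5 => a = e0 k 5 ∧ b = 0)
  let p : FreeAlgebra k (ZMod 5 ⊕ Unit) →ₐ[k] SkewGroup k 5 := RingQuot.mkAlgHom k (SGRel k 5)
  have hp {a b} (h : SGRel k 5 a b) : p a = p b := RingQuot.mkAlgHom_rel k h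
  refine exists_finrank_pow_le (x := fun i => q (xg k 5 i)) (s := q (sg k 5)) ?_ ?_ ?_ ?_ ?_
  · intro i j h
    rw [← map_mul, ← map_mul, ← map_add, xg, xg, ← map_mul, ← map_mul, ← map_add,
      hp (SGRel.anti i j h), map_zero, map_zero]
  · intro i
    rw [← map_mul, ← map_mul, xg, sg, xg, ← map_mul, ← map_mul, hp (SGRel.scomm i)]
  · rw [← map_pow, sg, ← map_pow, hp SGRel.spow, map_one, map_one]
  · have h : q (((5 : ℕ) : k)⁻¹ • ∑ i ∈ Finset.range 5, sg k 5 ^ i) = q 0 :=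
      RingQuot.mkAlgHom_rel k ⟨rfl, rfl⟩
    rw [map_smul, map_zero, smul_eq_zero] at h
    simpa using h.resolve_left (by norm_num)
  · have hsurj : Function.Surjective (q.comp p) :=
      (RingQuot.mkAlgHom_surjective k _).comp (RingQuot.mkAlgHom_surjective k _)
    rw [← AlgHom.range_eq_top, ← Algebra.map_top, ← FreeAlgebra.adjoin_range_ι,
      AlgHom.map_adjoin, ← Set.range_comp] at hsurj
    rw [← hsurj]
    congr 1
    ext b
    constructor
    · rintro (rfl | ⟨i, rfl⟩)
      exacts [⟨Sum.inr (), rfl⟩, ⟨Sum.inl i, rfl⟩]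
    · rintro ⟨i | _, rfl⟩
      exacts [Or.inr ⟨i, rfl⟩, Or.inl rfl]

theorem tendsto_log_div_log_of_linear {f : ℕ → ℕ} {C : ℕ} (h1 : ∀ m, m + 1 ≤ f m)
    (h2 : ∀ m, f m ≤ (m + 1) * C) :
    Filter.Tendsto (fun m : ℕ => Real.log (f m) / Real.log m) Filter.atTop (nhds 1) := by
  have hC : (0 : ℝ) < C := by
    have := (h1 0).trans (h2 0)
    have : 0 < C := by omega
    exact_mod_cast this
  have hlim : Filter.Tendsto (fun m : ℕ => Real.log (2 * C) / Real.log m + 1) Filter.atTop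
      (nhds 1) := by
    simpa using ((Real.tendsto_log_atTop.comp tendsto_natCast_atTop_atTop).const_div_atTop
      (Real.log (2 * C))).add_const 1
  refine tendsto_of_tendsto_of_tendsto_of_le_of_le' tendsto_const_nhds hlim ?_ ?_
  all_goals
    filter_upwards [Filter.eventually_ge_atTop 2] with m hm
    have hm' : (2 : ℝ) ≤ m := by exact_mod_cast hm
    have hlog : 0 < Real.log m := Real.log_pos (by linarith)
    have hf : (m : ℝ) ≤ f m := by exact_mod_cast (Nat.le_succ m).trans (h1 m)
  · rw [le_div_iff₀ hlog, one_mul]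
    exact Real.log_le_log (by linarith) hf
  · have hf2 : (f m : ℝ) ≤ (m + 1) * C := by exact_mod_cast h2 m
    rw [div_add_one hlog.ne', ← Real.log_mul (by positivity) (by linarith)]
    gcongr
    · linarith
    · nlinarith

end Main

end NCIS

open NCIS in
/-- Proposition 4.2: for `n = 5`, `GKdim E = 1`; equivalently the
pertinency `p(A, C₅) = 5 − GKdim E` equals `4`. -/
theorem gkdim_skewGroup_quotient_five
    (k : Type*) [Field k] [IsAlgClosed k] [CharZero k] :
    gkdim k (Equot k 5) (Vgen k 5) = 1 ∧
      (5 : ℝ) - gkdim k (Equot k 5) (Vgen k 5) = 4 := by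
  obtain ⟨I, hI⟩ := IsAlgClosed.exists_pow_nat_eq (-1 : k) (n := 2) (by norm_num)
  obtain ⟨C, hC⟩ := exists_finrank_Vgen_pow_le k
  have h : gkdim k (Equot k 5) (Vgen k 5) = 1 :=
    (tendsto_log_div_log_of_linear
      (succ_le_finrank_Vgen_pow (by rw [← pow_two, hI])) hC).limsup_eq
  exact ⟨h, by rw [h]; norm_num⟩
end

section
/- For each n ∈ {6, 9, 10}, GKdim E = 1; equivalently, the pertinency p(A, C_n) = n − GKdim E equals n − 1 (so p(A,C₆) = 5, p(A,C₉) = 8, and p(A,C₁₀) = 9). -/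
open scoped BigOperators

namespace NCIS

/-- Elements `X i`, `S` of a ring satisfying the defining relations of `(A # C_n)/(e₀)`. -/
structure IsKilledRep {B : Type*} [Ring B] {n : ℕ} (X : ZMod n → B) (S : B) : Prop where
  anti : ∀ i j, i ≠ j → X i * X j + X j * X i = 0
  pow_eq_one : S ^ n = 1
  comm : ∀ i, S * X i = X (i + 1) * S
  sum_pow : ∑ i ∈ Finset.range n, S ^ i = 0

namespace IsKilledRep

variable {B : Type*} [Ring B] {n : ℕ} {X : ZMod n → B} {S : B}

theorem pow_mul (h : IsKilledRep X S) (m : ℕ) (j : ZMod n) :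
    S ^ m * X j = X (j + m) * S ^ m := by
  induction m with
  | zero => simp
  | succ m ih =>
    rw [pow_succ', mul_assoc, ih, ← mul_assoc, h.comm, mul_assoc]
    push_cast
    rw [add_assoc]

theorem mul_eq_neg (h : IsKilledRep X S) {i j : ZMod n} (hij : i ≠ j) :
    X i * X j = -(X j * X i) :=
  eq_neg_of_add_eq_zero_left (h.anti i j hij)

theorem commute_sq (h : IsKilledRep X S) (i j : ZMod n) : Commute (X i ^ 2) (X j) := by
  by_cases hij : i = j
  · subst hij
    exact (Commute.refl _).pow_left 2
  · show X i ^ 2 * X j = X j * X i ^ 2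
    rw [sq, mul_assoc, h.mul_eq_neg hij, mul_neg, ← mul_assoc, h.mul_eq_neg hij, neg_mul, neg_neg,
      mul_assoc]

variable [NeZero n]

theorem pow_val_mul (h : IsKilledRep X S) (i j : ZMod n) :
    S ^ i.val * X j = X (j + i) * S ^ i.val := by
  rw [h.pow_mul, ZMod.natCast_val, ZMod.cast_id]

theorem pow_val_mul_sq (h : IsKilledRep X S) (i j : ZMod n) :
    S ^ i.val * X j ^ 2 = X (j + i) ^ 2 * S ^ i.val := by
  rw [sq, ← mul_assoc, h.pow_val_mul, mul_assoc, h.pow_val_mul, ← mul_assoc, sq]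

theorem sum_pow_val (h : IsKilledRep X S) : ∑ i : ZMod n, S ^ i.val = 0 := by
  rw [← h.sum_pow]
  obtain ⟨m, rfl⟩ := Nat.exists_eq_succ_of_ne_zero (NeZero.ne n)
  exact Fin.sum_univ_eq_sum_range (fun i => S ^ i) (m + 1)

end IsKilledRep

section Clifford

variable {B : Type*} [Ring B]

theorem clifford_two {a F C : ZMod 2 → B}
    (haF : ∀ i v, a i * F v = F (v + i) * a i) (hF : F 0 = 0)
    (ha : ∀ i j, a i * a j + a j * a i = C (i + j)) (v : ZMod 2) : C 0 * F v = 0 := by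
  have key : C 0 = a v * a v + a v * a v := by
    rw [ha, (by decide : ∀ v : ZMod 2, v + v = 0) v]
  have h : a v * F v = 0 := by
    rw [haF, (by decide : ∀ v : ZMod 2, v + v = 0) v, hF, zero_mul]
  rw [key, add_mul, mul_assoc, h, mul_zero, add_zero]

theorem clifford_three {a b F C C' : ZMod 3 → B}
    (haF : ∀ i v, a i * F v = F (v + i) * a i) (hbF : ∀ i v, b i * F v = F (v + i) * b i)
    (hF : F 0 = 0) (ha : ∀ i j, a i * a j + a j * a i = C (i + j))
    (hb : ∀ i j, b i * b j + b j * b i = C' (i + j)) (hab : ∀ i j, a i * b j + b j * a i = 0)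
    (v : ZMod 3) : C 0 * (C' 0 * F v) = 0 := by
  have hv : v + -v = 0 := by simp
  have hb0 : b (-v) * F v = 0 := by rw [hbF, hv, hF, zero_mul]
  have ha0 : a (-v) * F v = 0 := by rw [haF, hv, hF, zero_mul]
  have e1 : C' 0 * F v = b (-v) * (b v * F v) := by
    rw [← neg_add_cancel v, ← hb, add_mul, mul_assoc, mul_assoc, hb0, mul_zero, add_zero]
  have e2 : a v * (b (-v) * (b v * F v)) = 0 := by
    have h1 : a v * (b v * F v) = 0 := by
      rw [hbF, ← mul_assoc, haF, (by decide : ∀ v : ZMod 3, v + v + v = 0) v, hF, zero_mul,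
        zero_mul]
    rw [← mul_assoc, eq_neg_of_add_eq_zero_left (hab v (-v)), neg_mul, mul_assoc, h1, mul_zero,
      neg_zero]
  have e3 : a (-v) * (b (-v) * (b v * F v)) = 0 := by
    have h1 : a (-v) * (b v * F v) = 0 := by
      rw [← mul_assoc, eq_neg_of_add_eq_zero_left (hab (-v) v), neg_mul, mul_assoc, ha0, mul_zero,
        neg_zero]
    rw [← mul_assoc, eq_neg_of_add_eq_zero_left (hab (-v) (-v)), neg_mul, mul_assoc, h1, mul_zero,
      neg_zero]
  rw [e1, ← neg_add_cancel v, ← ha, add_mul, mul_assoc, mul_assoc, e2, e3]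
  simp

theorem clifford_five {a b F C C' : ZMod 5 → B}
    (haF : ∀ i v, a i * F v = F (v + i) * a i) (hbF : ∀ i v, b i * F v = F (v + i) * b i)
    (hF : F 0 = 0) (ha : ∀ i j, a i * a j + a j * a i = C (i + j))
    (hb : ∀ i j, b i * b j + b j * b i = C' (i + j)) (hab : ∀ i j, a i * b j + b j * a i = 0)
    (hCa : ∀ i, C 0 * a i = a i * C 0) (hCb : ∀ i, C 0 * b i = b i * C 0)
    (v : ZMod 5) : C 0 * (C 0 * (C' 0 * F v)) = 0 := by
  have hv : v + -v = 0 := by simp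
  have hab' : ∀ i j, a i * b j = -(b j * a i) := fun i j => eq_neg_of_add_eq_zero_left (hab i j)
  have hb0 : b (-v) * F v = 0 := by rw [hbF, hv, hF, zero_mul]
  have ha0 : a (-v) * F v = 0 := by rw [haF, hv, hF, zero_mul]
  have e1 : C 0 * F v = a (-v) * (a v * F v) := by
    rw [← neg_add_cancel v, ← ha, add_mul, mul_assoc, mul_assoc, ha0, mul_zero, add_zero]
  have e2 : b v * (b (-v) * (a v * F v)) = 0 := by
    have h1 : b (-v) * (a v * F v) = 0 := by
      rw [← mul_assoc, ← neg_eq_zero, ← neg_mul, ← hab', mul_assoc, hb0, mul_zero]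
    rw [h1, mul_zero]
  have e3 : C' 0 * (a v * F v) = b (-v) * (b v * (a v * F v)) := by
    rw [← neg_add_cancel v, ← hb, add_mul, mul_assoc, mul_assoc, e2, add_zero]
  have e4 : C 0 * (b v * (a v * F v)) = 0 := by
    have h2 : ∀ y, a (2 * v) * (F (3 * v) * y) = 0 := fun y => by
      rw [← mul_assoc, haF, (by decide : ∀ v : ZMod 5, 3 * v + 2 * v = 0) v, hF, zero_mul,
        zero_mul]
    have h3 : a (3 * v) * (b v * (a v * F v)) = 0 := by
      have : a (3 * v) * (a v * F v) = 0 := by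
        rw [haF, ← mul_assoc, haF, (by decide : ∀ v : ZMod 5, v + v + 3 * v = 0) v, hF, zero_mul,
          zero_mul]
      rw [← mul_assoc, hab', neg_mul, mul_assoc, this, mul_zero, neg_zero]
    have h4 : b v * (a v * F v) = F (3 * v) * (b v * a v) := by
      rw [haF, ← mul_assoc, hbF, mul_assoc, (by decide : ∀ v : ZMod 5, v + v + v = 3 * v) v]
    rw [← (by decide : ∀ v : ZMod 5, 3 * v + 2 * v = 0) v, ← ha, add_mul, mul_assoc, mul_assoc, h3,
      h4, h2, mul_zero, mul_zero, add_zero]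
  have hCC' : C 0 * C' 0 = C' 0 * C 0 := by
    rw [← add_zero (0 : ZMod 5), ← hb, add_zero, mul_add, add_mul, ← mul_assoc, hCb, mul_assoc,
      hCb, mul_assoc]
  have hC'a : ∀ i, C' 0 * a i = a i * C' 0 := fun i => by
    rw [← add_zero (0 : ZMod 5), ← hb, mul_add, add_mul, mul_assoc, ← neg_neg (b 0 * a i), ← hab',
      mul_neg, ← mul_assoc, ← neg_mul, ← hab', mul_assoc]
  calc C 0 * (C 0 * (C' 0 * F v)) = C 0 * (C' 0 * (C 0 * F v)) := by
        rw [← mul_assoc (C 0) (C' 0), hCC', mul_assoc]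
    _ = C 0 * (a (-v) * (C' 0 * (a v * F v))) := by
        rw [e1, ← mul_assoc (C' 0), hC'a, mul_assoc]
    _ = a (-v) * (b (-v) * (C 0 * (b v * (a v * F v)))) := by
        rw [e3, ← mul_assoc, hCa, mul_assoc, ← mul_assoc (C 0), hCb, mul_assoc]
    _ = 0 := by rw [e4, mul_zero, mul_zero]

end Clifford
end NCIS

namespace NCIS
namespace IsKilledRep

variable {k : Type*} [Field k] {B : Type*} [Ring B] [Algebra k B] {n : ℕ} [NeZero n]
  {X : ZMod n → B} {S : B} {Q : Type*} [CommRing Q] [Algebra k Q]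

theorem sum_prod_mul_pow_val (h : IsKilledRep X S) (φ : Q →ₐ[k] B) {w : ZMod n → Q}
    (hw : ∀ i j, S ^ i.val * φ (w j) = φ (w (j + i)) * S ^ i.val) (T : Finset (ZMod n))
    (j : ZMod n → ZMod n) :
    ∑ i, φ (∏ t ∈ T, (w (j t + i) - w (j t + t))) * S ^ i.val = 0 := by
  classical
  induction T using Finset.induction_on with
  | empty => simpa using h.sum_pow_val
  | insert t T ht ih =>
    have : ∀ i, φ (∏ t ∈ insert t T, (w (j t + i) - w (j t + t))) * S ^ i.val =
        φ (∏ t ∈ T, (w (j t + i) - w (j t + t))) * S ^ i.val * φ (w (j t)) -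
        φ (w (j t + t)) * (φ (∏ t ∈ T, (w (j t + i) - w (j t + t))) * S ^ i.val) := fun i => by
      rw [Finset.prod_insert ht, mul_assoc _ (S ^ _), hw, ← mul_assoc, ← mul_assoc, ← map_mul,
        ← map_mul, ← sub_mul, ← map_sub]
      congr 2
      ring
    simp_rw [this]
    rw [Finset.sum_sub_distrib, ← Finset.sum_mul, ← Finset.mul_sum, ih]
    simp

theorem map_prod_sub_eq_zero (h : IsKilledRep X S) (φ : Q →ₐ[k] B) {z : ZMod n → Q}
    (hz : ∀ i, φ (z i) = X i ^ 2) (j : ZMod n → ZMod n) :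
    φ (∏ t ∈ Finset.univ.erase 0, (z (j t) - z (j t + t))) = 0 := by
  have := h.sum_prod_mul_pow_val φ (w := z) (fun i j => by rw [hz, hz, h.pow_val_mul_sq])
    (Finset.univ.erase 0) j
  rw [Finset.sum_eq_single 0] at this
  · simpa using this
  · intro i _ hi
    rw [Finset.prod_eq_zero (i := i) (by simp [hi]) (by simp), map_zero, zero_mul]
  · simp

/-- The sum of `z` over the coset of `j` modulo the image of `ι`. -/
def cosetSum {M : Type*} [AddCommMonoid M] {p : ℕ} [NeZero p] (z : ZMod n → M)
    (ι : ZMod p →+ ZMod n) (j : ZMod n) : M :=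
  ∑ c, z (j + ι c)

open Classical in
/-- A product of differences of coset sums, one for each element outside the image of `ι`. -/
noncomputable def separator {p : ℕ} [NeZero p] (z : ZMod n → Q)
    (ι : ZMod p →+ ZMod n) (j : ZMod n → ZMod n) : Q :=
  ∏ t with t ∉ Set.range ι, (cosetSum z ι (j t) - cosetSum z ι (j t + t))

variable {p : ℕ} [NeZero p]

theorem cosetSum_add {M : Type*} [AddCommMonoid M] (z : ZMod n → M)
    (ι : ZMod p →+ ZMod n) (j : ZMod n) (c : ZMod p) :
    cosetSum z ι (j + ι c) = cosetSum z ι j := by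
  unfold cosetSum
  rw [← Equiv.sum_comp (Equiv.addLeft c) (fun d => z (j + ι d))]
  simp [add_assoc]

theorem separator_mul_sum (h : IsKilledRep X S) (φ : Q →ₐ[k] B) {z : ZMod n → Q}
    (hz : ∀ i, φ (z i) = X i ^ 2) (ι : ZMod p →+ ZMod n) (hι : Function.Injective ι)
    (j : ZMod n → ZMod n) : φ (separator z ι j) * ∑ c, S ^ (ι c).val = 0 := by
  classical
  have := h.sum_prod_mul_pow_val φ (w := cosetSum z ι)
    (fun i j => by
      simp only [cosetSum, map_sum, Finset.mul_sum, Finset.sum_mul, hz, h.pow_val_mul_sq]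
      exact Finset.sum_congr rfl fun c _ => by rw [add_right_comm])
    (Finset.univ.filter (· ∉ Set.range ι)) j
  rw [Finset.mul_sum, ← this]
  refine Finset.sum_bij_ne_zero (fun c _ _ => ι c) (by simp) (fun _ _ _ _ _ _ e => hι e) ?_ ?_
  · intro i _ hi
    by_cases hr : i ∈ Set.range ι
    · obtain ⟨c, rfl⟩ := hr
      refine ⟨c, Finset.mem_univ _, ?_, rfl⟩
      simp_rw [cosetSum_add] at hi
      unfold separator
      convert hi using 4
    · exact absurd (by
        rw [Finset.prod_eq_zero (i := i) (by simpa using hr) (by simp), map_zero, zero_mul]) hi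
  · intro c _ _
    simp_rw [cosetSum_add]
    unfold separator
    congr!

/-- The twisted coset sum `∑ c, e (i c) X (j + ι c)`. -/
def twist (X : ZMod n → B) (ι : ZMod p →+ ZMod n) (e : AddChar (ZMod p) k) (j : ZMod n)
    (i : ZMod p) : B :=
  ∑ c, e (i * c) • X (j + ι c)

theorem twist_mul_twist (h : IsKilledRep X S) (ι : ZMod p →+ ZMod n) (hι : Function.Injective ι)
    (e : AddChar (ZMod p) k) (j : ZMod n) (i l : ZMod p) :
    twist X ι e j i * twist X ι e j l + twist X ι e j l * twist X ι e j i =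
      ∑ c, (2 * e ((i + l) * c)) • X (j + ι c) ^ 2 := by
  classical
  have : ∀ c d, (e (i * c) • X (j + ι c)) * (e (l * d) • X (j + ι d)) +
      (e (l * d) • X (j + ι d)) * (e (i * c) • X (j + ι c)) =
      if c = d then (2 * e ((i + l) * c)) • X (j + ι c) ^ 2 else 0 := by
    intro c d
    split_ifs with hcd
    · subst hcd
      rw [smul_mul_smul_comm, smul_mul_smul_comm, ← sq, ← add_smul, add_mul, AddChar.map_add_eq_mul]
      congr 1
      ring
    · rw [smul_mul_smul_comm, smul_mul_smul_comm, mul_comm (e (l * d)), ← smul_add, h.anti,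
        smul_zero]
      exact fun e => hcd (hι (add_left_cancel e))
  unfold twist
  rw [Finset.sum_mul_sum, Finset.sum_mul_sum, Finset.sum_comm (s := Finset.univ (α := ZMod p))
    (f := fun c d => (e (l * c) • X (j + ι c)) * (e (i * d) • X (j + ι d))),
    ← Finset.sum_add_distrib]
  simp_rw [← Finset.sum_add_distrib, this]
  simp

theorem twist_anticomm (h : IsKilledRep X S) (ι : ZMod p →+ ZMod n)
    (e : AddChar (ZMod p) k) {x y : ZMod n} (hxy : y - x ∉ Set.range ι) (i l : ZMod p) :
    twist X ι e x i * twist X ι e y l + twist X ι e y l * twist X ι e x i = 0 := by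
  unfold twist
  rw [Finset.sum_mul_sum, Finset.sum_mul_sum, Finset.sum_comm (s := Finset.univ (α := ZMod p))
    (f := fun c d => (e (l * c) • X (y + ι c)) * (e (i * d) • X (x + ι d))),
    ← Finset.sum_add_distrib]
  refine Finset.sum_eq_zero fun c _ => ?_
  rw [← Finset.sum_add_distrib]
  refine Finset.sum_eq_zero fun d _ => ?_
  rw [smul_mul_smul_comm, smul_mul_smul_comm, mul_comm (e (l * d)), ← smul_add, h.anti, smul_zero]
  intro he
  exact hxy ⟨c - d, by rw [map_sub, sub_eq_sub_iff_add_eq_add, add_comm, he, add_comm]⟩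

theorem commute_twist (h : IsKilledRep X S) (ι : ZMod p →+ ZMod n)
    (e : AddChar (ZMod p) k) (j l : ZMod n) (i : ZMod p) :
    Commute (X l ^ 2) (twist X ι e j i) :=
  Commute.sum_right _ _ _ fun _ _ => (h.commute_sq _ _).smul_right _

theorem pow_val_mul_twist (h : IsKilledRep X S) (ι : ZMod p →+ ZMod n)
    (e : AddChar (ZMod p) k) (j : ZMod n) (i c : ZMod p) :
    e (i * c) • (S ^ (ι c).val * twist X ι e j i) = twist X ι e j i * S ^ (ι c).val := by
  unfold twist
  rw [Finset.mul_sum, Finset.sum_mul, Finset.smul_sum]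
  rw [← Equiv.sum_comp (Equiv.addLeft c) (fun d => (e (i * d) • X (j + ι d)) * S ^ (ι c).val)]
  refine Finset.sum_congr rfl fun d _ => ?_
  simp only [Equiv.coe_addLeft]
  rw [mul_smul_comm, h.pow_val_mul, smul_smul, smul_mul_assoc, ← AddChar.map_add_eq_mul, mul_add,
    ι.map_add, add_comm (ι c), add_assoc]

end IsKilledRep
end NCIS

namespace NCIS
namespace IsKilledRep

variable {k : Type*} [Field k] {B : Type*} [Ring B] [Algebra k B] {n : ℕ} [NeZero n]
  {X : ZMod n → B} {S : B} {Q : Type*} [CommRing Q] [Algebra k Q] {p : ℕ} [NeZero p]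

theorem cosetSum_relation [IsAlgClosed k] [CharZero k] (h : IsKilledRep X S) (φ : Q →ₐ[k] B)
    (hφ : Function.Injective φ) {z : ZMod n → Q} (hz : ∀ i, φ (z i) = X i ^ 2)
    (hzgen : Algebra.adjoin k (Set.range z) = ⊤) (hp : p = 2 ∨ p = 3 ∨ p = 5)
    (ι : ZMod p →+ ZMod n) (hι : Function.Injective ι) (j : ZMod n → ZMod n) {x y : ZMod n}
    (hxy : y - x ∉ Set.range ι) :
    cosetSum z ι x ^ 2 * cosetSum z ι y * separator z ι j = 0 := by
  classical
  obtain ⟨ζ, hζ⟩ := HasEnoughRootsOfUnity.exists_primitiveRoot k p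
  set e : AddChar (ZMod p) k := AddChar.zmodChar p hζ.pow_eq_one
  have heprim : e.IsPrimitive := AddChar.zmodChar_primitive_of_primitive_root p hζ
  set D : B := φ (separator z ι j) with hD
  have hcomm : ∀ (q : Q) (l : ZMod n) (i : ZMod p), Commute (φ q) (twist X ι e l i) := by
    intro q l i
    have hq : q ∈ Algebra.adjoin k (Set.range z) := hzgen ▸ Algebra.mem_top
    induction hq using Algebra.adjoin_induction with
    | mem q hq =>
      obtain ⟨m, rfl⟩ := hq
      rw [hz]
      exact h.commute_twist ι e l m i
    | algebraMap r => rw [AlgHom.commutes]; exact Algebra.commute_algebraMap_left r _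
    | add a b _ _ ha hb => rw [map_add]; exact ha.add_left hb
    | mul a b _ _ ha hb => rw [map_mul]; exact ha.mul_left hb
  set F : ZMod p → B := fun v => D * ∑ c, e (v * c) • S ^ (ι c).val with hF
  have hF0 : F 0 = 0 := by
    simpa [hF] using h.separator_mul_sum φ hz ι hι j
  have haF : ∀ l i v, twist X ι e l i * F v = F (v + i) * twist X ι e l i := by
    intro l i v
    rw [hF]
    simp only
    rw [← mul_assoc, ← (hcomm _ l i).eq, mul_assoc, mul_assoc, Finset.mul_sum, Finset.sum_mul]
    congr 1
    refine Finset.sum_congr rfl fun c _ => ?_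
    rw [mul_smul_comm, ← h.pow_val_mul_twist ι e l i c, smul_smul, smul_mul_assoc, add_mul,
      AddChar.map_add_eq_mul]
  have hsum : ∑ v, F v = (p : k) • D := by
    simp only [hF]
    rw [← Finset.mul_sum, Finset.sum_comm]
    simp_rw [← Finset.sum_smul, AddChar.sum_mulShift _ heprim]
    rw [Finset.sum_eq_single 0]
    · simp [ZMod.card]
    · intro c _ hc
      simp [hc]
    · simp
  have hC : ∀ l, ∑ c, (2 * e ((0 : ZMod p) * c)) • X (l + ι c) ^ 2 =
      (2 : k) • φ (cosetSum z ι l) := by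
    intro l
    simp [cosetSum, map_sum, hz, Finset.smul_sum]
  have key : ∀ v, (2 : k) • φ (cosetSum z ι x) *
      ((2 : k) • φ (cosetSum z ι x) * ((2 : k) • φ (cosetSum z ι y) * F v)) = 0 := by
    intro v
    have hCx := fun i => ((hcomm (cosetSum z ι x) x i).smul_left (2 : k)).eq
    have hCy := fun i => ((hcomm (cosetSum z ι x) y i).smul_left (2 : k)).eq
    rw [← hC] at hCx hCy
    rw [← hC, ← hC]
    rcases hp with rfl | rfl | rfl
    · have := clifford_two (C := fun γ => ∑ c, (2 * e (γ * c)) • X (y + ι c) ^ 2)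
        (haF y) hF0 (h.twist_mul_twist ι hι e y) v
      rw [this, mul_zero, mul_zero]
    · have := clifford_three (C := fun γ => ∑ c, (2 * e (γ * c)) • X (x + ι c) ^ 2)
        (C' := fun γ => ∑ c, (2 * e (γ * c)) • X (y + ι c) ^ 2) (haF x) (haF y) hF0
        (h.twist_mul_twist ι hι e x) (h.twist_mul_twist ι hι e y) (h.twist_anticomm ι e hxy) v
      rw [this, mul_zero]
    · exact clifford_five (C := fun γ => ∑ c, (2 * e (γ * c)) • X (x + ι c) ^ 2)
        (C' := fun γ => ∑ c, (2 * e (γ * c)) • X (y + ι c) ^ 2) (haF x) (haF y) hF0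
        (h.twist_mul_twist ι hι e x) (h.twist_mul_twist ι hι e y) (h.twist_anticomm ι e hxy) hCx
        hCy v
  have key2 : (2 : k) • φ (cosetSum z ι x) *
      ((2 : k) • φ (cosetSum z ι x) * ((2 : k) • φ (cosetSum z ι y) * ∑ v, F v)) = 0 := by
    rw [Finset.mul_sum, Finset.mul_sum, Finset.mul_sum]
    exact Finset.sum_eq_zero fun v _ => key v
  rw [hsum] at key2
  simp only [mul_smul_comm, smul_mul_assoc, smul_smul, hD, ← map_mul] at key2
  rw [smul_eq_zero] at key2
  have hne : (p : k) ≠ 0 := Nat.cast_ne_zero.mpr (NeZero.ne p)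
  rcases key2 with h0 | h0
  · simp [hne] at h0
  · apply hφ
    rw [map_zero, ← h0]
    ring_nf

end IsKilledRep

section Domain

open IsKilledRep

variable {k : Type*} [Field k] [CharZero k] {n : ℕ} [NeZero n] {K : Type*} [CommRing K]
  [IsDomain K] [Algebra k K]

/-- The periods of a function on `ZMod n`. -/
def periods (z : ZMod n → K) : AddSubgroup (ZMod n) where
  carrier := {t | ∀ j, z j = z (j + t)}
  zero_mem' := by simp
  add_mem' := fun {a b} ha hb j => by rw [← add_assoc, ← hb, ← ha]
  neg_mem' := fun {a} ha j => by rw [ha (j + -a), neg_add_cancel_right]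

theorem separator_map {Q : Type*} [CommRing Q] (f : Q →+* K) {p : ℕ} [NeZero p] (z : ZMod n → Q)
    (ι : ZMod p →+ ZMod n) (j : ZMod n → ZMod n) :
    f (separator z ι j) = separator (f ∘ z) ι j := by
  simp [separator, cosetSum]

theorem eq_zero_or_of_periods_eq_range [CharZero K] {z : ZMod n → K} {p : ℕ} [NeZero p]
    (ι : ZMod p →+ ZMod n)
    (hι : Function.Injective ι) (hper : (periods z : Set (ZMod n)) = Set.range ι)
    (hrel : ∀ j x y, y - x ∉ Set.range ι →
      cosetSum z ι x ^ 2 * cosetSum z ι y * separator z ι j = 0) (i : ZMod n) :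
    z i = 0 ∨ ∑ l, z l = p * z i := by
  classical
  have hp : (p : K) ≠ 0 := Nat.cast_ne_zero.mpr (NeZero.ne p)
  have hσ : ∀ x, cosetSum z ι x = p * z x := by
    intro x
    have : ∀ c, z (x + ι c) = z x := fun c => by
      have : ι c ∈ (periods z : Set (ZMod n)) := hper ▸ ⟨c, rfl⟩
      exact (this x).symm
    simp [cosetSum, this, ZMod.card]
  have hj : ∀ t, ∃ j, t ∉ Set.range ι → z j ≠ z (j + t) := by
    intro t
    by_cases ht : t ∈ Set.range ι
    · exact ⟨0, fun h => absurd ht h⟩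
    · rw [← hper] at ht
      obtain ⟨j, hj⟩ := not_forall.mp ht
      exact ⟨j, fun _ => hj⟩
  choose j hj using hj
  have hsep : separator z ι j ≠ 0 := by
    unfold separator
    rw [Finset.prod_ne_zero_iff]
    intro t ht
    rw [hσ, hσ, ← mul_sub]
    exact mul_ne_zero hp (sub_ne_zero.mpr (hj t (by simpa using ht)))
  by_cases hi : z i = 0
  · exact Or.inl hi
  · right
    have hzero : ∀ y, y - i ∉ Set.range ι → z y = 0 := by
      intro y hy
      have := hrel j i y hy
      rw [hσ, hσ] at this
      simpa [hp, hi, hsep] using this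
    rw [← hσ, cosetSum]
    symm
    refine Finset.sum_bij_ne_zero (fun c _ _ => i + ι c) (by simp)
      (fun _ _ _ _ _ _ e => hι (add_left_cancel e)) ?_ (fun _ _ _ => rfl)
    intro y _ hy
    by_cases hr : y - i ∈ Set.range ι
    · obtain ⟨c, hc⟩ := hr
      have : i + ι c = y := by rw [hc]; abel
      exact ⟨c, Finset.mem_univ _, by rwa [this], this⟩
    · exact absurd (hzero y hr) hy

theorem eq_zero_or_exists_sum_eq [CharZero K]
    (hn : ∀ d, d ∣ n → d = 1 ∨ d = n ∨ d = 2 ∨ d = 3 ∨ d = 5)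
    {z : ZMod n → K}
    (h0 : ∀ j : ZMod n → ZMod n, ∏ t ∈ Finset.univ.erase 0, (z (j t) - z (j t + t)) = 0)
    (hrel : ∀ (p : ℕ) [NeZero p] (_ : p = 2 ∨ p = 3 ∨ p = 5) (ι : ZMod p →+ ZMod n)
      (_ : Function.Injective ι) (j x y), y - x ∉ Set.range ι →
      cosetSum z ι x ^ 2 * cosetSum z ι y * separator z ι j = 0) (i : ZMod n) :
    z i = 0 ∨ ∃ c ∈ Finset.Icc 1 n, ∑ l, z l = c * z i := by
  classical
  have hdvd : Nat.card (periods z) ∣ n := by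
    simpa using AddSubgroup.card_addSubgroup_dvd_card (periods z)
  have hle := Nat.le_of_dvd (NeZero.pos n) hdvd
  rcases hn _ hdvd with hc | hc | hc
  · exfalso
    have hbot : periods z = ⊥ := AddSubgroup.eq_bot_of_card_eq _ hc
    have : ∀ t, ∃ j, t ≠ 0 → z j ≠ z (j + t) := by
      intro t
      by_cases ht : t = 0
      · exact ⟨0, fun h => absurd ht h⟩
      · have : t ∉ periods z := by simpa [hbot] using ht
        obtain ⟨j, hj⟩ := not_forall.mp this
        exact ⟨j, fun _ => hj⟩
    choose j hj using this
    obtain ⟨t, ht, h⟩ := Finset.prod_eq_zero_iff.mp (h0 j)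
    exact hj t (Finset.ne_of_mem_erase ht) (sub_eq_zero.mp h)
  · right
    have htop : periods z = ⊤ := AddSubgroup.eq_top_of_card_eq _ (by simpa using hc)
    refine ⟨n, by simp [NeZero.one_le], ?_⟩
    have : ∀ l, z l = z i := fun l => by
      have : l - i ∈ periods z := htop ▸ AddSubgroup.mem_top _
      rw [this i, add_sub_cancel]
    simp [this, ZMod.card]
  · have : Fact (Nat.card (periods z)).Prime :=
      ⟨by rcases hc with hc | hc | hc <;> rw [hc] <;> norm_num⟩
    have : NeZero (Nat.card (periods z)) := ⟨this.out.ne_zero⟩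
    let eqv := zmodAddCyclicAddEquiv (isAddCyclic_of_prime_card (α := periods z) rfl)
    let ι := (periods z).subtype.comp eqv.toAddMonoidHom
    have hι : Function.Injective ι := Subtype.val_injective.comp eqv.injective
    have hran : (periods z : Set (ZMod n)) = Set.range ι := by
      ext t
      constructor
      · intro ht
        exact ⟨eqv.symm ⟨t, ht⟩, by simp [ι]⟩
      · rintro ⟨c, rfl⟩
        exact (eqv c).2
    exact (eq_zero_or_of_periods_eq_range ι hι hran (fun j x y => hrel _ hc ι hι j x y) i).imp_right
      fun h => ⟨_, Finset.mem_Icc.mpr ⟨NeZero.one_le, hle⟩, h⟩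

end Domain
end NCIS

namespace NCIS
namespace IsKilledRep

open Polynomial

variable {k : Type*} [Field k] {B : Type*} [Ring B] [Algebra k B] {n : ℕ} [NeZero n]
  {X : ZMod n → B} {S : B} {Q : Type*} [CommRing Q] [Algebra k Q]

theorem isNilpotent_mul_prod [IsAlgClosed k] [CharZero k] (h : IsKilledRep X S) (φ : Q →ₐ[k] B)
    (hφ : Function.Injective φ) {z : ZMod n → Q} (hz : ∀ i, φ (z i) = X i ^ 2)
    (hzgen : Algebra.adjoin k (Set.range z) = ⊤)
    (hn : ∀ d, d ∣ n → d = 1 ∨ d = n ∨ d = 2 ∨ d = 3 ∨ d = 5) (i : ZMod n) :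
    IsNilpotent (z i * ∏ c ∈ Finset.Icc 1 n, (z i - (c : k)⁻¹ • ∑ l, z l)) := by
  rw [nilpotent_iff_mem_prime]
  intro P hP
  rw [← Ideal.Quotient.eq_zero_iff_mem]
  have : CharZero (Q ⧸ P) := charZero_of_injective_algebraMap (algebraMap k (Q ⧸ P)).injective
  set f := Ideal.Quotient.mk P
  have hcases := eq_zero_or_exists_sum_eq hn (z := f ∘ z)
    (fun j => by
      have h0 : ∏ t ∈ Finset.univ.erase 0, (z (j t) - z (j t + t)) = 0 :=
        hφ (by rw [h.map_prod_sub_eq_zero φ hz, map_zero])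
      simpa using congrArg f h0)
    (fun p _ hp ι hι j x y hxy => by
      have h0 := h.cosetSum_relation φ hφ hz hzgen hp ι hι j hxy
      simpa [separator_map, cosetSum] using congrArg f h0) i
  rcases hcases with h0 | ⟨c, hc, h0⟩
  · rw [map_mul, show f (z i) = 0 from h0, zero_mul]
  · rw [map_mul, map_prod, Finset.prod_eq_zero hc, mul_zero]
    have hc0 : (c : k) ≠ 0 := by
      have := (Finset.mem_Icc.mp hc).1
      exact Nat.cast_ne_zero.mpr (by omega)
    have h1 : f ((c : k)⁻¹ • ∑ l, z l) = (c : k)⁻¹ • f (∑ l, z l) := rfl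
    have h2 : f (∑ l, z l) = (c : k) • f (z i) := by
      rw [map_sum, ← Function.comp_def f z, h0, Algebra.smul_def, map_natCast]
      rfl
    rw [map_sub, h1, h2, smul_smul, inv_mul_cancel₀ hc0, one_smul, sub_self]

theorem finite_aeval {z : ZMod n → Q} (hzgen : Algebra.adjoin k (Set.range z) = ⊤) (u : Q)
    (hnil : ∀ i, IsNilpotent (z i * ∏ c ∈ Finset.Icc 1 n, (z i - (c : k)⁻¹ • u))) :
    (aeval u : k[X] →ₐ[k] Q).toRingHom.Finite := by
  algebraize [(aeval u : k[X] →ₐ[k] Q).toRingHom]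
  have htower : IsScalarTower k k[X] Q := IsScalarTower.of_algebraMap_eq fun r => by
    simp [RingHom.algebraMap_toAlgebra]
  have hu : IsIntegral k[X] u := by
    have : u = algebraMap k[X] Q Polynomial.X := by simp [RingHom.algebraMap_toAlgebra]
    rw [this]
    exact isIntegral_algebraMap
  have hft : Algebra.FiniteType k Q :=
    ⟨⟨(Set.finite_range z).toFinset, by simpa using hzgen⟩⟩
  have hft' : Algebra.FiniteType k[X] Q := Algebra.FiniteType.of_restrictScalars_finiteType k _ _
  have hint : ∀ i, IsIntegral k[X] (z i) := by
    intro i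
    obtain ⟨N, hN⟩ := hnil i
    refine ⟨(Polynomial.X * ∏ c ∈ Finset.Icc 1 n,
      (Polynomial.X - C ((c : k)⁻¹ • (Polynomial.X : k[X])))) ^ N, ?_, ?_⟩
    · exact (monic_X.mul (monic_prod_of_monic _ _ fun c _ => monic_X_sub_C _)).pow N
    · rw [eval₂_pow, eval₂_mul, eval₂_finsetProd]
      simp only [eval₂_X, eval₂_sub, eval₂_C]
      convert hN using 6
      simp [RingHom.algebraMap_toAlgebra]
  have hall : Algebra.IsIntegral k[X] Q := ⟨fun q => by
    have hq : q ∈ Algebra.adjoin k (Set.range z) := hzgen ▸ Algebra.mem_top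
    induction hq using Algebra.adjoin_induction with
    | mem q hq => obtain ⟨m, rfl⟩ := hq; exact hint m
    | algebraMap r =>
      rw [IsScalarTower.algebraMap_apply k k[X] Q]
      exact isIntegral_algebraMap
    | add a b _ _ ha hb => exact ha.add hb
    | mul a b _ _ ha hb => exact ha.mul hb⟩
  exact (Algebra.IsIntegral.finite : Module.Finite k[X] Q)

theorem exists_mul_map_eq (h : IsKilledRep X S) (φ : Q →ₐ[k] B) {z : ZMod n → Q}
    (hz : ∀ i, φ (z i) = X i ^ 2) (hzgen : Algebra.adjoin k (Set.range z) = ⊤) (q : Q) :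
    ∃ q', S * φ q = φ q' * S := by
  have hq : q ∈ Algebra.adjoin k (Set.range z) := hzgen ▸ Algebra.mem_top
  induction hq using Algebra.adjoin_induction with
  | mem q hq =>
    obtain ⟨m, rfl⟩ := hq
    exact ⟨z (m + 1), by
      rw [hz, hz, sq, ← mul_assoc, h.comm, mul_assoc, h.comm, ← mul_assoc, sq]⟩
  | algebraMap r => exact ⟨algebraMap k Q r, by rw [AlgHom.commutes, Algebra.commutes]⟩
  | add a b _ _ ha hb =>
    obtain ⟨a', ha⟩ := ha
    obtain ⟨b', hb⟩ := hb
    exact ⟨a' + b', by rw [map_add, mul_add, ha, hb, map_add, add_mul]⟩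
  | mul a b _ _ ha hb =>
    obtain ⟨a', ha⟩ := ha
    obtain ⟨b', hb⟩ := hb
    exact ⟨a' * b', by rw [map_mul, ← mul_assoc, ha, mul_assoc, hb, map_mul, mul_assoc]⟩

theorem commute_map (h : IsKilledRep X S) (φ : Q →ₐ[k] B) {z : ZMod n → Q}
    (hz : ∀ i, φ (z i) = X i ^ 2) (hzgen : Algebra.adjoin k (Set.range z) = ⊤) (q : Q)
    (i : ZMod n) : Commute (φ q) (X i) := by
  have hq : q ∈ Algebra.adjoin k (Set.range z) := hzgen ▸ Algebra.mem_top
  induction hq using Algebra.adjoin_induction with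
  | mem q hq =>
    obtain ⟨m, rfl⟩ := hq
    rw [hz]
    exact h.commute_sq m i
  | algebraMap r => rw [AlgHom.commutes]; exact Algebra.commute_algebraMap_left r _
  | add a b _ _ ha hb => rw [map_add]; exact ha.add_left hb
  | mul a b _ _ ha hb => rw [map_mul]; exact ha.mul_left hb

theorem mul_list_prod (h : IsKilledRep X S) {i : ZMod n} {l : List (ZMod n)} (hi : i ∉ l) :
    X i * (l.map X).prod = (-1 : Bˣ) ^ l.length • ((l.map X).prod * X i) := by
  induction l with
  | nil => simp
  | cons m l ih =>
    rw [List.mem_cons, not_or] at hi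
    rw [List.map_cons, List.prod_cons, ← mul_assoc, h.mul_eq_neg hi.1, neg_mul, mul_assoc,
      ih hi.2, List.length_cons]
    rcases Nat.even_or_odd l.length with hl | hl <;>
      simp [pow_succ, hl.neg_one_pow, Units.smul_def, mul_assoc]

theorem mul_list_prod_eq_shift (h : IsKilledRep X S) (l : List (ZMod n)) :
    S * (l.map X).prod = ((l.map (· + 1)).map X).prod * S := by
  induction l with
  | nil => simp
  | cons m l ih =>
    rw [List.map_cons, List.prod_cons, ← mul_assoc, h.comm, mul_assoc, ih]
    simp [mul_assoc]

theorem finite_module (h : IsKilledRep X S)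
    (hgen : Algebra.adjoin k (insert S (Set.range X)) = ⊤) (φ : Q →ₐ[k] B) {z : ZMod n → Q}
    (hz : ∀ i, φ (z i) = X i ^ 2) (hzgen : Algebra.adjoin k (Set.range z) = ⊤) :
    letI : Module Q B := Module.compHom B φ.toRingHom
    Module.Finite Q B := by
  let : Module Q B := Module.compHom B φ.toRingHom
  have hsmul : ∀ (q : Q) (b : B), q • b = φ q * b := fun q b => rfl
  let word : {l : List (ZMod n) // l.Nodup} × ZMod n → B :=
    fun w => (w.1.1.map X).prod * S ^ w.2.val
  let N : Submodule Q B := Submodule.span Q (Set.range word)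
  have hword : ∀ (l : List (ZMod n)) (_ : l.Nodup) (c : ZMod n),
      (l.map X).prod * S ^ c.val ∈ N := fun l hl c => Submodule.subset_span ⟨(⟨l, hl⟩, c), rfl⟩
  have hX : ∀ (i : ZMod n), ∀ y ∈ N, X i * y ∈ N := by
    intro i y hy
    induction hy using Submodule.span_induction with
    | mem y hy =>
      obtain ⟨⟨⟨l, hl⟩, c⟩, rfl⟩ := hy
      by_cases hi : i ∈ l
      · obtain ⟨l₁, l₂, rfl⟩ := List.append_of_mem hi
        have hi₁ : i ∉ l₁ := by
          rw [List.nodup_append] at hl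
          exact fun hmem => hl.2.2 i hmem i (by simp) rfl
        have hl' : (l₁ ++ l₂).Nodup :=
          hl.sublist ((List.sublist_cons_self i l₂).append_left l₁)
        have key : X i * (((l₁ ++ i :: l₂).map X).prod * S ^ c.val) =
            (-1 : Bˣ) ^ l₁.length • (z i • (((l₁ ++ l₂).map X).prod * S ^ c.val)) := by
          have hc : Commute (X i ^ 2) (l₁.map X).prod := Commute.list_prod_right _ _ (by
            intro b hb
            obtain ⟨m, _, rfl⟩ := List.mem_map.mp hb
            exact h.commute_sq i m)
          rw [hsmul, hz]
          simp only [List.map_append, List.map_cons, List.prod_append, List.prod_cons]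
          rw [← mul_assoc, ← mul_assoc, h.mul_list_prod hi₁]
          simp only [smul_mul_assoc]
          congr 1
          simp only [← mul_assoc]
          rw [hc.eq]
          simp only [sq, mul_assoc]
        show X i * (((l₁ ++ i :: l₂).map X).prod * S ^ c.val) ∈ N
        rw [key]
        have := N.smul_mem (z i) (hword _ hl' c)
        rcases Nat.even_or_odd l₁.length with he | ho
        · simpa [he.neg_one_pow] using this
        · simpa [ho.neg_one_pow, Units.smul_def] using this
      · have := hword (i :: l) (List.nodup_cons.mpr ⟨hi, hl⟩) c
        simpa [mul_assoc] using this
    | zero => simp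
    | add a b _ _ ha hb => rw [mul_add]; exact N.add_mem ha hb
    | smul q y _ ih =>
      rw [hsmul, ← mul_assoc, ← (h.commute_map φ hz hzgen q i).eq, mul_assoc, ← hsmul]
      exact N.smul_mem q ih
  have hS : ∀ y ∈ N, S * y ∈ N := by
    intro y hy
    induction hy using Submodule.span_induction with
    | mem y hy =>
      obtain ⟨⟨⟨l, hl⟩, c⟩, rfl⟩ := hy
      have hS1 : S * S ^ c.val = S ^ (c + 1).val := by
        rw [ZMod.val_add, ← pow_eq_pow_mod _ h.pow_eq_one, pow_add, ZMod.val_one_eq_one_mod,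
          ← pow_eq_pow_mod _ h.pow_eq_one, pow_one, ← pow_succ, ← pow_succ']
      show S * ((l.map X).prod * S ^ c.val) ∈ N
      rw [← mul_assoc, h.mul_list_prod_eq_shift, mul_assoc, hS1]
      exact hword _ (hl.map (add_left_injective 1)) _
    | zero => simp
    | add a b _ _ ha hb => rw [mul_add]; exact N.add_mem ha hb
    | smul q y _ ih =>
      obtain ⟨q', hq'⟩ := h.exists_mul_map_eq φ hz hzgen q
      rw [hsmul, ← mul_assoc, hq', mul_assoc, ← hsmul]
      exact N.smul_mem q' ih
  have hall : ∀ b : B, ∀ y ∈ N, b * y ∈ N := by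
    intro b
    have hb : b ∈ Algebra.adjoin k (insert S (Set.range X)) := hgen ▸ Algebra.mem_top
    induction hb using Algebra.adjoin_induction with
    | mem b hb =>
      rcases hb with rfl | ⟨i, rfl⟩
      · exact hS
      · exact hX i
    | algebraMap r =>
      intro y hy
      have := N.smul_mem (algebraMap k Q r) hy
      rwa [hsmul, AlgHom.commutes] at this
    | add a b _ _ ha hb => intro y hy; rw [add_mul]; exact N.add_mem (ha y hy) (hb y hy)
    | mul a b _ _ ha hb => intro y hy; rw [mul_assoc]; exact ha _ (hb y hy)
  have hone : (1 : B) ∈ N := by simpa using hword [] List.nodup_nil 0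
  have htop : N = ⊤ := eq_top_iff.mpr fun b _ => by simpa using hall b 1 hone
  have : Fintype {l : List (ZMod n) // l.Nodup} := fintypeNodupList
  exact ⟨(Submodule.fg_def).mpr ⟨Set.range word, Set.finite_range word, htop⟩⟩

theorem exists_finset_of_algHom [IsAlgClosed k] [CharZero k] (h : IsKilledRep X S)
    (hgen : Algebra.adjoin k (insert S (Set.range X)) = ⊤)
    (hn : ∀ d, d ∣ n → d = 1 ∨ d = n ∨ d = 2 ∨ d = 3 ∨ d = 5) (φ : Q →ₐ[k] B)
    (hφ : Function.Injective φ) {z : ZMod n → Q} (hz : ∀ i, φ (z i) = X i ^ 2)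
    (hzgen : Algebra.adjoin k (Set.range z) = ⊤) :
    ∃ s : Finset B, ∀ b : B, ∃ P : B → k[X], b = ∑ f ∈ s, aeval (∑ i, X i ^ 2) (P f) * f := by
  have hfin := finite_aeval hzgen (∑ l, z l) (h.isNilpotent_mul_prod φ hφ hz hzgen hn)
  have hmod := h.finite_module hgen φ hz hzgen
  let := Module.compHom B φ.toRingHom
  algebraize [(aeval (∑ l, z l) : k[X] →ₐ[k] Q).toRingHom]
  let := Module.compHom B (φ.comp (aeval (∑ l, z l) : k[X] →ₐ[k] Q)).toRingHom
  have hsmul : ∀ (q : k[X]) (b : B), q • b = aeval (∑ i, X i ^ 2) q * b := fun q b => by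
    have : (φ.comp (aeval (∑ l, z l) : k[X] →ₐ[k] Q)) q = aeval (∑ i, X i ^ 2) q := by
      rw [← Polynomial.aeval_algHom]
      simp [hz]
    rw [← this]
    rfl
  have htower : IsScalarTower k[X] Q B := ⟨fun q r b => by
    show φ (aeval (∑ l, z l) q * r) * b = φ (aeval (∑ l, z l) q) * (φ r * b)
    rw [map_mul, mul_assoc]⟩
  obtain ⟨s, hs⟩ := (Module.Finite.trans Q B : Module.Finite k[X] B).fg_top
  refine ⟨s, fun b => ?_⟩
  have hb : b ∈ Submodule.span k[X] (s : Set B) := hs ▸ Submodule.mem_top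
  obtain ⟨P, _, hP⟩ := Submodule.mem_span_finset.mp hb
  exact ⟨P, by rw [← hP]; simp only [hsmul]⟩

/-- `B` is finite over the polynomial algebra in the central element `∑ i, X i ^ 2`. -/
theorem exists_finset_span_pow_mul [IsAlgClosed k] [CharZero k] (h : IsKilledRep X S)
    (hgen : Algebra.adjoin k (insert S (Set.range X)) = ⊤)
    (hn : ∀ d, d ∣ n → d = 1 ∨ d = n ∨ d = 2 ∨ d = 3 ∨ d = 5) :
    ∃ s : Finset B, ∀ b : B, ∃ P : B → k[X], b = ∑ f ∈ s, aeval (∑ i, X i ^ 2) (P f) * f := by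
  have hcomm : IsMulCommutative (Algebra.adjoin k (Set.range fun i => X i ^ 2)) :=
    Algebra.isMulCommutative_adjoin k (by
      rintro _ ⟨i, rfl⟩ _ ⟨j, rfl⟩
      exact ((h.commute_sq i j).pow_right 2).eq)
  let : CommRing (Algebra.adjoin k (Set.range fun i => X i ^ 2)) :=
    { Subalgebra.toRing _ with mul_comm := hcomm.is_comm.comm }
  let z : ZMod n → Algebra.adjoin k (Set.range fun i => X i ^ 2) :=
    fun i => ⟨X i ^ 2, Algebra.subset_adjoin ⟨i, rfl⟩⟩
  have hzgen : Algebra.adjoin k (Set.range z) = ⊤ := by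
    have := Algebra.adjoin_adjoin_coe_preimage (R := k) (s := Set.range fun i => X i ^ 2)
    convert this using 2
    ext q
    simp [z, Subtype.ext_iff]
  exact h.exists_finset_of_algHom hgen hn (Subalgebra.val _) Subtype.val_injective (z := z)
    (fun i => rfl) hzgen

end IsKilledRep
end NCIS

namespace NCIS

section Growth

open Polynomial Filter Topology

variable {k : Type*} [Field k] {B : Type*} [Ring B] [Algebra k B]

theorem exists_finrank_pow_le_s16 {u : B} (hu : ∀ b, Commute u b) {s : Finset B}
    (hs : ∀ b : B, ∃ P : B → k[X], b = ∑ f ∈ s, aeval u (P f) * f)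
    {V : Submodule k B} (hV : V.FG) :
    ∃ C : ℕ, ∀ m : ℕ, Module.finrank k (V ^ m : Submodule k B) ≤ C * (m + 1) := by
  classical
  let N : ℕ → Submodule k B := fun d =>
    Submodule.span k ((Finset.range (d + 1) ×ˢ s).image fun x => u ^ x.1 * x.2 : Finset B)
  have hN : ∀ {d i f}, i ≤ d → f ∈ s → u ^ i * f ∈ N d := fun {d i f} hi hf =>
    Submodule.subset_span (by
      simp only [Finset.coe_image, Set.mem_image, Finset.mem_coe, Finset.mem_product]
      exact ⟨(i, f), ⟨by simpa [Nat.lt_succ_iff] using hi, hf⟩, rfl⟩)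
  have hmono : Monotone N := fun d d' hd => by
    refine Submodule.span_mono ?_
    gcongr
  have hex : ∀ b, ∃ d, b ∈ N d := by
    intro b
    obtain ⟨P, hP⟩ := hs b
    refine ⟨s.sup fun f => (P f).natDegree, ?_⟩
    rw [hP]
    refine Submodule.sum_mem _ fun f hf => ?_
    rw [aeval_eq_sum_range, Finset.sum_mul]
    refine Submodule.sum_mem _ fun i hi => ?_
    rw [smul_mul_assoc]
    refine Submodule.smul_mem _ _ (hN ?_ hf)
    exact (Nat.lt_succ_iff.mp (Finset.mem_range.mp hi)).trans
      (Finset.le_sup (f := fun f => (P f).natDegree) hf)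
  obtain ⟨t, ht⟩ := hV
  choose deg hdeg using hex
  let D := max (deg 1) ((t ×ˢ s).sup fun x => deg (x.1 * x.2))
  have hstep : ∀ d, V * N d ≤ N (D + d) := by
    intro d
    rw [← ht, Submodule.span_mul_span, Submodule.span_le]
    rintro _ ⟨v, hv, w, hw, rfl⟩
    simp only [Finset.coe_image, Set.mem_image, Finset.mem_coe, Finset.mem_product] at hw
    obtain ⟨⟨i, f⟩, ⟨hi, hf⟩, rfl⟩ := hw
    have h1 : v * f ∈ N D := hmono (le_max_of_le_right
      (Finset.le_sup (f := fun x : B × B => deg (x.1 * x.2)) (Finset.mk_mem_product hv hf)))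
      (hdeg (v * f))
    have h2 : ∀ y ∈ N D, u ^ i * y ∈ N (D + d) := by
      intro y hy
      induction hy using Submodule.span_induction with
      | mem y hy =>
        simp only [Finset.coe_image, Set.mem_image, Finset.mem_coe, Finset.mem_product] at hy
        obtain ⟨⟨j, g⟩, ⟨hj, hg⟩, rfl⟩ := hy
        rw [← mul_assoc, ← pow_add]
        refine hN ?_ hg
        simp only [Finset.mem_range] at hi hj
        omega
      | zero => simp
      | add a b _ _ ha hb => rw [mul_add]; exact Submodule.add_mem _ ha hb
      | smul c y _ ih => rw [mul_smul_comm]; exact Submodule.smul_mem _ c ih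
    have h3 : v * (u ^ i * f) = u ^ i * (v * f) := by
      rw [← mul_assoc, ← ((hu v).pow_left i).eq, mul_assoc]
    show v * (u ^ i * f) ∈ N (D + d)
    rw [h3]
    exact h2 _ h1
  have hpow : ∀ m, V ^ m * N D ≤ N (D * (m + 1)) := by
    intro m
    induction m with
    | zero => simp
    | succ m ih =>
      rw [pow_succ', mul_assoc]
      refine (mul_le_mul' le_rfl ih).trans ((hstep _).trans (hmono ?_))
      apply le_of_eq
      ring
  have hone : (1 : Submodule k B) ≤ N D := by
    rw [Submodule.one_le]
    exact hmono (le_max_left _ _) (hdeg 1)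
  refine ⟨(D + 1) * s.card, fun m => ?_⟩
  have hle : V ^ m ≤ N (D * (m + 1)) := by
    refine le_trans ?_ (hpow m)
    calc V ^ m = V ^ m * 1 := (mul_one _).symm
      _ ≤ V ^ m * N D := mul_le_mul' le_rfl hone
  calc Module.finrank k (V ^ m : Submodule k B)
      ≤ Module.finrank k (N (D * (m + 1))) := Submodule.finrank_mono hle
    _ ≤ _ := finrank_span_finset_le_card _
    _ ≤ (Finset.range (D * (m + 1) + 1) ×ˢ s).card := Finset.card_image_le
    _ = (D * (m + 1) + 1) * s.card := by simp
    _ ≤ (D + 1) * s.card * (m + 1) := by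
      have : D * (m + 1) + 1 ≤ (D + 1) * (m + 1) := by nlinarith
      calc _ ≤ (D + 1) * (m + 1) * s.card := Nat.mul_le_mul_right _ this
        _ = _ := by ring

theorem succ_le_finrank_pow {V : Submodule k B} (hV : V.FG) (h1 : (1 : B) ∈ V) {x : B} (hx : x ∈ V)
    (hli : LinearIndependent k fun j : ℕ => x ^ j) (m : ℕ) :
    m + 1 ≤ Module.finrank k (V ^ m : Submodule k B) := by
  have hmem : ∀ j : Fin (m + 1), x ^ (j : ℕ) ∈ V ^ m := fun j =>
    pow_le_pow_right' (Submodule.one_le.mpr h1) (Nat.lt_succ_iff.mp j.2)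
      (Submodule.pow_mem_pow V hx j)
  have hli' : LinearIndependent k fun j : Fin (m + 1) =>
      (⟨x ^ (j : ℕ), hmem j⟩ : (V ^ m : Submodule k B)) := by
    apply LinearIndependent.of_comp (V ^ m : Submodule k B).subtype
    exact hli.comp (fun j : Fin (m + 1) => (j : ℕ)) Fin.val_injective
  have : Module.Finite k (V ^ m : Submodule k B) := Module.Finite.iff_fg.mpr (hV.pow m)
  simpa using hli'.fintype_card_le_finrank

theorem gkdim_eq_one {V : Submodule k B}
    (hlow : ∀ m, m + 1 ≤ Module.finrank k (V ^ m : Submodule k B)) {C : ℕ}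
    (hup : ∀ m, Module.finrank k (V ^ m : Submodule k B) ≤ C * (m + 1)) :
    gkdim k B V = 1 := by
  have hlog : Tendsto (fun m : ℕ => Real.log m) atTop atTop :=
    Real.tendsto_log_atTop.comp tendsto_natCast_atTop_atTop
  have hC : 0 < C := by
    have := (hlow 0).trans (hup 0)
    by_contra h
    simp [Nat.eq_zero_of_not_pos h] at this
  have hC' : (0 : ℝ) < C := Nat.cast_pos.mpr hC
  apply Tendsto.limsup_eq
  have hupper :
      Tendsto (fun m : ℕ => (Real.log (2 * C) + Real.log m) / Real.log m) atTop (𝓝 1) := by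
    have h0 : Tendsto (fun m : ℕ => Real.log (2 * C) / Real.log m + 1) atTop (𝓝 (0 + 1)) :=
      (hlog.const_div_atTop _).add_const 1
    rw [zero_add] at h0
    refine h0.congr' ?_
    filter_upwards [hlog.eventually_gt_atTop 0] with m hm
    rw [add_div, div_self hm.ne']
  refine tendsto_of_tendsto_of_tendsto_of_le_of_le' tendsto_const_nhds hupper ?_ ?_
  · filter_upwards [hlog.eventually_gt_atTop 0, eventually_ge_atTop 1] with m hm hm1
    rw [le_div_iff₀ hm, one_mul]
    apply Real.log_le_log (by exact_mod_cast hm1)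
    exact_mod_cast (Nat.le_succ m).trans (hlow m)
  · filter_upwards [hlog.eventually_gt_atTop 0, eventually_ge_atTop 1] with m hm hm1
    have hmpos : (0 : ℝ) < m := by exact_mod_cast hm1
    rw [← Real.log_mul (by positivity) hmpos.ne']
    have hpos : 0 < Module.finrank k (V ^ m : Submodule k B) := (Nat.succ_pos m).trans_le (hlow m)
    refine div_le_div_of_nonneg_right (Real.log_le_log (by exact_mod_cast hpos) ?_) hm.le
    have h1 : Module.finrank k (V ^ m : Submodule k B) ≤ 2 * C * m := by
      refine (hup m).trans ?_
      nlinarith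
    exact_mod_cast h1

end Growth
end NCIS

namespace NCIS

/-- An integer matrix which, suitably twisted by roots of unity, yields a representation of
`(A # C_n)/(e₀)` for every multiple `n` of `p`, in which `x_0` is not nilpotent. -/
structure IsSeed {p : ℕ} [NeZero p] (M : ZMod p → ZMod p → ℤ) (c : ℤ) : Prop where
  row_zero : ∀ v, M 0 v = 0
  col_zero : ∀ w, M w 0 = 0
  exists_ne : ∃ w v, M w v ≠ 0
  const_ne : c ≠ 0
  cube : ∀ w v, ∑ x, ∑ y, M w x * M x y * M y v = c * M w v
  twist : ∀ w v i,
    M w i * M i v + M w (w + v - i) * M (w + v - i) v = M w (w + v) * M (w + v) v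

/-- The seed for multiples of `3`. -/
def seedThree : ZMod 3 → ZMod 3 → ℤ :=
  (!![0, 0, 0; 0, 1, 2; 0, 1, -1] : Matrix (Fin 3) (Fin 3) ℤ)

/-- The seed for multiples of `5`. -/
def seedFive : ZMod 5 → ZMod 5 → ℤ :=
  (!![0, 0, 0, 0, 0; 0, 1, 2, 2, 0; 0, 1, -1, 0, -2; 0, 1, 0, -1, 2; 0, 0, -1, 1, 1] :
    Matrix (Fin 5) (Fin 5) ℤ)

theorem isSeed_seedThree : IsSeed seedThree 3 where
  row_zero := by decide
  col_zero := by decide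
  exists_ne := ⟨1, 1, by decide⟩
  const_ne := by decide
  cube := by decide
  twist := by decide

theorem isSeed_seedFive : IsSeed seedFive 5 where
  row_zero := by decide
  col_zero := by decide
  exists_ne := ⟨1, 1, by decide⟩
  const_ne := by decide
  cube := by decide
  twist := by decide

section SeedRep

variable {k : Type*} [Field k] {n p : ℕ} [NeZero n] [NeZero p]

/-- The matrices representing the `x_i` attached to a seed `M` and a character `χ` of `ZMod n`. -/
def seedX (hpn : p ∣ n) (χ : AddChar (ZMod n) k) (M : ZMod p → ZMod p → ℤ) (i : ZMod n) :
    Matrix (ZMod n) (ZMod n) k :=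
  .of fun w v => χ (i * (w - v)) *
    (M (ZMod.castHom hpn (ZMod p) w) (ZMod.castHom hpn (ZMod p) v) : k)

/-- The eigenvalues of the matrix representing `s`. -/
def seedEigenvalue (hpn : p ∣ n) (v : ZMod n) : ZMod n :=
  if ZMod.castHom hpn (ZMod p) v = 0 then 1 else v

/-- The diagonal matrix representing `s` attached to a character `χ` of `ZMod n`. -/
def seedS (hpn : p ∣ n) (χ : AddChar (ZMod n) k) : Matrix (ZMod n) (ZMod n) k :=
  .diagonal fun v => χ (seedEigenvalue hpn v)

variable (hpn : p ∣ n) {χ : AddChar (ZMod n) k} {M : ZMod p → ZMod p → ℤ} {c : ℤ}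

theorem sum_char_mul_eq_zero (hχ : ∀ a, χ a = 1 → a = 0) {d : ZMod n} (hd : d ≠ 0) :
    ∑ y, χ (d * y) = 0 := by
  have h := AddChar.sum_eq_zero_of_ne_one (ψ := χ.mulShift d) (fun h => hd (hχ d (by
    simpa using DFunLike.congr_fun h 1)))
  simpa [AddChar.mulShift_apply] using h

theorem IsSeed.twisted_sum_eq_zero (h : IsSeed M c) (hχ : ∀ a, χ a = 1 → a = 0) {d : ZMod n}
    (hd : d ≠ 0) (w v : ZMod n) :
    ∑ y, (M (ZMod.castHom hpn (ZMod p) w) (ZMod.castHom hpn (ZMod p) y) : k) *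
      M (ZMod.castHom hpn (ZMod p) y) (ZMod.castHom hpn (ZMod p) v) *
        (χ (d * y) + χ (d * (w + v - y))) = 0 := by
  simp only [mul_add, Finset.sum_add_distrib]
  rw [← Equiv.sum_comp (Equiv.subLeft (w + v)) (fun y => (M (ZMod.castHom hpn (ZMod p) w)
    (ZMod.castHom hpn (ZMod p) y) : k) * M (ZMod.castHom hpn (ZMod p) y)
    (ZMod.castHom hpn (ZMod p) v) * χ (d * (w + v - y))), ← Finset.sum_add_distrib]
  simp only [Equiv.subLeft_apply, sub_sub_cancel, ← add_mul, map_sub, map_add]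
  have htw : ∀ a b i, (M a i : k) * M i b + M a (a + b - i) * M (a + b - i) b =
      M a (a + b) * M (a + b) b := fun a b i => by 
      exact_mod_cast congrArg (Int.cast : ℤ → k) (h.twist a b i)
  simp only [htw, ← Finset.mul_sum, sum_char_mul_eq_zero hχ hd, mul_zero]

theorem IsSeed.isKilledRep (h : IsSeed M c) (hp : p ≠ 1) (hχ : ∀ a, χ a = 1 → a = 0) :
    IsKilledRep (seedX hpn χ M) (seedS hpn χ) where
  anti i j hij := by
    ext w v
    have key := h.twisted_sum_eq_zero hpn hχ (sub_ne_zero.mpr hij.symm) w v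
    simp only [Matrix.add_apply, Matrix.mul_apply, seedX, Matrix.of_apply, Matrix.zero_apply,
      ← Finset.sum_add_distrib]
    rw [← mul_zero (χ (i * w - j * v)), ← key, Finset.mul_sum]
    refine Finset.sum_congr rfl fun y _ => ?_
    have h1 : χ (i * (w - y)) * χ (j * (y - v)) = χ (i * w - j * v) * χ ((j - i) * y) := by
      rw [← AddChar.map_add_eq_mul, ← AddChar.map_add_eq_mul]
      congr 1
      ring
    have h2 : χ (j * (w - y)) * χ (i * (y - v)) =
        χ (i * w - j * v) * χ ((j - i) * (w + v - y)) := by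
      rw [← AddChar.map_add_eq_mul, ← AddChar.map_add_eq_mul]
      congr 1
      ring
    linear_combination ((M (ZMod.castHom hpn (ZMod p) w) (ZMod.castHom hpn (ZMod p) y) : k) *
      M (ZMod.castHom hpn (ZMod p) y) (ZMod.castHom hpn (ZMod p) v)) * (h1 + h2)
  pow_eq_one := by
    rw [seedS, Matrix.diagonal_pow, ← Matrix.diagonal_one]
    congr 1
    ext v
    simp [← AddChar.map_nsmul_eq_pow]
  comm i := by
    ext w v
    rw [seedS, Matrix.diagonal_mul, Matrix.mul_diagonal]
    simp only [seedX, Matrix.of_apply, seedEigenvalue]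
    by_cases hw : ZMod.castHom hpn (ZMod p) w = 0
    · simp [hw, h.row_zero]
    by_cases hv : ZMod.castHom hpn (ZMod p) v = 0
    · simp [hv, h.col_zero]
    rw [if_neg hw, if_neg hv, ← mul_assoc, ← AddChar.map_add_eq_mul, mul_right_comm,
      ← AddChar.map_add_eq_mul]
    congr 2
    ring
  sum_pow := by
    simp only [seedS, Matrix.diagonal_pow]
    ext w v
    rw [Matrix.sum_apply]
    by_cases hwv : w = v
    · subst hwv
      have hne : seedEigenvalue hpn w ≠ 0 := by
        unfold seedEigenvalue
        split_ifs with h0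
        · intro h1
          have := congrArg (ZMod.castHom hpn (ZMod p)) h1
          rw [map_one, map_zero] at this
          exact hp ((ZMod.one_eq_zero_iff).mp this)
        · rintro rfl
          exact h0 (map_zero _)
      have hne' : χ (seedEigenvalue hpn w) ≠ 1 := fun h1 => hne (hχ _ h1)
      simp only [Matrix.diagonal_apply_eq, Pi.pow_apply, Matrix.zero_apply]
      rw [geom_sum_eq hne', ← AddChar.map_nsmul_eq_pow]
      simp
    · simp [Matrix.diagonal_apply_ne _ hwv]

theorem sum_castHom (g : ZMod p → k) :
    ∑ y, g (ZMod.castHom hpn (ZMod p) y) =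
      (Finset.univ.filter fun y => ZMod.castHom hpn (ZMod p) y = 0).card * ∑ y, g y := by
  rw [← Finset.sum_fiberwise _ (ZMod.castHom hpn (ZMod p)), Finset.mul_sum]
  refine Finset.sum_congr rfl fun a _ => ?_
  rw [Finset.sum_congr rfl (g := fun _ => g a) (fun y hy => by rw [(Finset.mem_filter.mp hy).2]),
    Finset.sum_const, nsmul_eq_mul]
  congr 2
  exact AddMonoidHom.card_fiber_eq_of_mem_range (ZMod.castHom hpn (ZMod p) : ZMod n →+ ZMod p)
    (ZMod.castHom_surjective hpn a) (ZMod.castHom_surjective hpn 0)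

theorem IsSeed.seedX_zero_pow_ne_zero [CharZero k] (h : IsSeed M c) (j : ℕ) :
    seedX hpn χ M 0 ^ j ≠ 0 := by
  set A := seedX hpn χ M 0 with hA
  set q : k := ((Finset.univ.filter fun y => ZMod.castHom hpn (ZMod p) y = 0).card : k) with hq
  have hAe : ∀ w v, A w v = (M (ZMod.castHom hpn (ZMod p) w) (ZMod.castHom hpn (ZMod p) v) : k) :=
    fun w v => by simp [hA, seedX]
  have hq0 : q ≠ 0 := by
    rw [hq, Nat.cast_ne_zero, Finset.card_ne_zero]
    exact ⟨0, Finset.mem_filter.mpr ⟨Finset.mem_univ _, map_zero _⟩⟩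
  have hcube : A * A * A = (q ^ 2 * c) • A := by
    ext w v
    have hc := congrArg (Int.cast : ℤ → k)
      (h.cube (ZMod.castHom hpn (ZMod p) w) (ZMod.castHom hpn (ZMod p) v))
    push_cast at hc
    rw [Finset.sum_comm] at hc
    simp only [Matrix.mul_apply, hAe, Matrix.smul_apply, smul_eq_mul, Finset.sum_mul]
    rw [mul_assoc, ← hc, sum_castHom hpn (fun b => ∑ x, (M (ZMod.castHom hpn (ZMod p) w)
      (ZMod.castHom hpn (ZMod p) x) : k) * M (ZMod.castHom hpn (ZMod p) x) b *
      M b (ZMod.castHom hpn (ZMod p) v)), ← hq, sq, mul_assoc]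
    refine congrArg (q * ·) ?_
    rw [Finset.mul_sum]
    refine Finset.sum_congr rfl fun b _ => ?_
    exact sum_castHom hpn (fun a => (M (ZMod.castHom hpn (ZMod p) w) a : k) * M a b *
      M b (ZMod.castHom hpn (ZMod p) v))
  have hA0 : A ≠ 0 := by
    obtain ⟨a, b, hab⟩ := h.exists_ne
    obtain ⟨w, rfl⟩ := ZMod.castHom_surjective hpn a
    obtain ⟨v, rfl⟩ := ZMod.castHom_surjective hpn b
    intro h0
    have := hAe w v
    rw [h0, Matrix.zero_apply] at this
    exact hab (by exact_mod_cast this.symm)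
  have hodd : ∀ i : ℕ, A ^ (2 * i + 1) = (q ^ 2 * c) ^ i • A := by
    intro i
    induction i with
    | zero => simp
    | succ i ih =>
      rw [show 2 * (i + 1) + 1 = 2 * i + 1 + 1 + 1 by ring, pow_succ, pow_succ, ih,
        smul_mul_assoc, smul_mul_assoc, hcube, smul_smul,
        pow_succ (q ^ 2 * (c : k))]
  intro hj
  have hz : A ^ (2 * j + 1) = 0 := by
    rw [show 2 * j + 1 = j + (j + 1) by ring, pow_add, hj, zero_mul]
  rw [hodd] at hz
  refine (smul_ne_zero (pow_ne_zero _ (mul_ne_zero (pow_ne_zero _ hq0) ?_)) hA0) hz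
  exact_mod_cast h.const_ne

end SeedRep
end NCIS

namespace NCIS

open Polynomial

section Universal

variable {k : Type*} [Field k] {n : ℕ}

variable (k n) in
/-- The image of `x_i` in `E`. -/
noncomputable def quotX (i : ZMod n) : Equot k n :=
  RingQuot.mkAlgHom k (fun a b : SkewGroup k n => a = e0 k n ∧ b = 0) (xg k n i)

variable (k n) in
/-- The image of `s` in `E`. -/
noncomputable def quotS : Equot k n :=
  RingQuot.mkAlgHom k (fun a b : SkewGroup k n => a = e0 k n ∧ b = 0) (sg k n)

theorem isKilledRep_quot [CharZero k] [NeZero n] : IsKilledRep (quotX k n) (quotS k n) where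
  anti i j hij := by
    have h := RingQuot.mkAlgHom_rel k (SGRel.anti (k := k) i j hij)
    simp only [map_add, map_mul, map_zero] at h
    have h' := congrArg (RingQuot.mkAlgHom k fun a b : SkewGroup k n => a = e0 k n ∧ b = 0) h
    simpa only [map_add, map_mul, map_zero, quotX, xg] using h'
  pow_eq_one := by
    have h := RingQuot.mkAlgHom_rel k (SGRel.spow (k := k) (n := n))
    simp only [map_pow, map_one] at h
    have h' := congrArg (RingQuot.mkAlgHom k fun a b : SkewGroup k n => a = e0 k n ∧ b = 0) h
    simpa only [map_pow, map_one, quotS, sg] using h'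
  comm i := by
    have h := RingQuot.mkAlgHom_rel k (SGRel.scomm (k := k) i)
    simp only [map_mul] at h
    have h' := congrArg (RingQuot.mkAlgHom k fun a b : SkewGroup k n => a = e0 k n ∧ b = 0) h
    simpa only [map_mul, quotX, quotS, xg, sg] using h'
  sum_pow := by
    have h := RingQuot.mkAlgHom_rel k (s := fun a b : SkewGroup k n => a = e0 k n ∧ b = 0)
      (⟨rfl, rfl⟩ : e0 k n = e0 k n ∧ (0 : SkewGroup k n) = 0)
    rw [e0, map_smul, map_zero, map_sum] at h
    simp only [map_pow] at h
    exact (smul_eq_zero.mp h).resolve_left (inv_ne_zero (Nat.cast_ne_zero.mpr (NeZero.ne n)))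

theorem adjoin_quot : Algebra.adjoin k (insert (quotS k n) (Set.range (quotX k n))) = ⊤ := by
  rw [eq_top_iff]
  rintro b -
  obtain ⟨a, rfl⟩ := RingQuot.mkAlgHom_surjective k _ b
  obtain ⟨f, rfl⟩ := RingQuot.mkAlgHom_surjective k _ a
  induction f using FreeAlgebra.induction with
  | grade0 r => simp only [AlgHom.commutes]; exact Subalgebra.algebraMap_mem _ r
  | grade1 x =>
    apply Algebra.subset_adjoin
    rcases x with i | ⟨⟩
    · exact Set.mem_insert_of_mem _ ⟨i, rfl⟩
    · exact Set.mem_insert _ _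
  | mul a b ha hb => simp only [map_mul]; exact mul_mem ha hb
  | add a b ha hb => simp only [map_add]; exact add_mem ha hb

theorem IsKilledRep.exists_algHom {B : Type*} [Ring B] [Algebra k B] {X : ZMod n → B} {S : B}
    (h : IsKilledRep X S) : ∃ φ : Equot k n →ₐ[k] B, ∀ i, φ (quotX k n i) = X i := by
  let f : FreeAlgebra k (ZMod n ⊕ Unit) →ₐ[k] B := FreeAlgebra.lift k (Sum.elim X fun _ => S)
  have hf : ∀ ⦃a b⦄, SGRel k n a b → f a = f b := by
    intro a b hab
    cases hab with
    | anti i j hij => simpa [f] using h.anti i j hij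
    | spow => simpa [f] using h.pow_eq_one
    | scomm i => simpa [f] using h.comm i
  let g : SkewGroup k n →ₐ[k] B := RingQuot.liftAlgHom k ⟨f, hf⟩
  have hgs : g (sg k n) = S := by simp [g, sg, f]
  have hgx : ∀ i, g (xg k n i) = X i := fun i => by simp [g, xg, f]
  have hg : ∀ ⦃a b⦄, (a = e0 k n ∧ b = 0) → g a = g b := by
    rintro _ _ ⟨rfl, rfl⟩
    rw [e0, map_smul, map_sum, map_zero]
    simp only [map_pow, hgs, h.sum_pow, smul_zero]
  exact ⟨RingQuot.liftAlgHom k ⟨g, hg⟩, fun i => by simp [quotX, hgx]⟩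

theorem IsKilledRep.polynomial {B : Type*} [Ring B] {X : ZMod n → B} {S : B}
    (h : IsKilledRep X S) : IsKilledRep (fun i => monomial 1 (X i)) (C S) where
  anti i j hij := by
    simp only [monomial_mul_monomial, ← map_add, h.anti i j hij, map_zero]
  pow_eq_one := by rw [← C_pow, h.pow_eq_one, C_1]
  comm i := by rw [C_mul_monomial, monomial_mul_C, h.comm]
  sum_pow := by simp only [← C_pow, ← map_sum, h.sum_pow, map_zero]

theorem IsKilledRep.linearIndependent_quotX_pow {B : Type*} [Ring B] [Algebra k B]
    {X : ZMod n → B} {S : B} (h : IsKilledRep X S) {i : ZMod n} (hi : ∀ j : ℕ, X i ^ j ≠ 0) :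
    LinearIndependent k fun j : ℕ => quotX k n i ^ j := by
  obtain ⟨φ, hφ⟩ := h.polynomial.exists_algHom (k := k)
  apply LinearIndependent.of_comp φ.toLinearMap
  have hcomp : (φ.toLinearMap ∘ fun j : ℕ => quotX k n i ^ j) = fun j => monomial j (X i ^ j) := by
    ext1 j
    simp [hφ, monomial_pow]
  rw [hcomp, linearIndependent_iff']
  intro s g hg j hj
  have hc := congrArg (fun P => coeff P j) hg
  simp only [finsetSum_coeff, coeff_smul, coeff_monomial, coeff_zero, smul_ite, smul_zero,
    Finset.sum_ite_eq', hj, if_true] at hc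
  exact (smul_eq_zero.mp hc).resolve_right (hi j)

theorem IsKilledRep.commute_sum_sq {B : Type*} [Ring B] [Algebra k B] [NeZero n]
    {X : ZMod n → B} {S : B} (h : IsKilledRep X S)
    (hgen : Algebra.adjoin k (insert S (Set.range X)) = ⊤) (b : B) :
    Commute (∑ i, X i ^ 2) b := by
  have hb : b ∈ Algebra.adjoin k (insert S (Set.range X)) := hgen ▸ Algebra.mem_top
  induction hb using Algebra.adjoin_induction with
  | mem x hx =>
    rcases hx with rfl | ⟨j, rfl⟩
    · show _ * _ = _ * _
      rw [Finset.mul_sum, Finset.sum_mul, ← Equiv.sum_comp (Equiv.addRight (1 : ZMod n))]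
      refine Finset.sum_congr rfl fun i _ => ?_
      rw [Equiv.coe_addRight, sq, sq, mul_assoc, ← h.comm, ← mul_assoc, ← h.comm, mul_assoc]
    · exact Finset.sum_induction _ (fun y => Commute y (X j)) (fun _ _ => Commute.add_left)
        (Commute.zero_left _) fun i _ => h.commute_sq i j
  | algebraMap r => exact (Algebra.commutes r _).symm
  | add x y _ _ hx hy => exact hx.add_right hy
  | mul x y _ _ hx hy => exact hx.mul_right hy

theorem IsKilledRep.gkdim_span_eq_one [IsAlgClosed k] [CharZero k] [NeZero n] {B : Type*} [Ring B]
    [Algebra k B] {X : ZMod n → B} {S : B} (h : IsKilledRep X S)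
    (hgen : Algebra.adjoin k (insert S (Set.range X)) = ⊤)
    (hn : ∀ d, d ∣ n → d = 1 ∨ d = n ∨ d = 2 ∨ d = 3 ∨ d = 5) {i : ZMod n}
    (hli : LinearIndependent k fun j : ℕ => X i ^ j) :
    gkdim k B (Submodule.span k (insert 1 (insert S (Set.range X)))) = 1 := by
  obtain ⟨s, hs⟩ := h.exists_finset_span_pow_mul hgen hn
  have hfg := Submodule.fg_span (R := k) (((Set.finite_range X).insert S).insert 1)
  obtain ⟨C, hC⟩ := exists_finrank_pow_le_s16 (h.commute_sum_sq hgen) hs hfg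
  refine gkdim_eq_one (succ_le_finrank_pow hfg ?_ ?_ hli) hC
  · exact Submodule.subset_span (Set.mem_insert _ _)
  · exact Submodule.subset_span (Set.mem_insert_of_mem _ (Set.mem_insert_of_mem _ ⟨i, rfl⟩))

end Universal

theorem gkdim_Equot_eq_one {k : Type*} [Field k] [IsAlgClosed k] [CharZero k] {n p : ℕ} [NeZero n]
    [NeZero p] (hn : ∀ d, d ∣ n → d = 1 ∨ d = n ∨ d = 2 ∨ d = 3 ∨ d = 5) (hpn : p ∣ n)
    (hp : p ≠ 1) {M : ZMod p → ZMod p → ℤ} {c : ℤ} (hM : IsSeed M c) :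
    gkdim k (Equot k n) (Vgen k n) = 1 := by
  obtain ⟨ω, hω⟩ := HasEnoughRootsOfUnity.exists_primitiveRoot k n
  have hχ : ∀ a, AddChar.zmodChar n hω.pow_eq_one a = 1 → a = 0 := by
    intro a ha
    rw [AddChar.zmodChar_apply] at ha
    exact (ZMod.val_eq_zero a).mp
      (Nat.eq_zero_of_dvd_of_lt (hω.dvd_of_pow_eq_one _ ha) (ZMod.val_lt a))
  have hli := (hM.isKilledRep hpn hp hχ).linearIndependent_quotX_pow (k := k)
    (hM.seedX_zero_pow_ne_zero hpn)
  exact isKilledRep_quot.gkdim_span_eq_one adjoin_quot hn hli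

end NCIS

open NCIS in
/-- Lemmas 9.1, 9.2, 9.3: for each `n ∈ {6, 9, 10}`, `GKdim E = 1`;
equivalently the pertinency `p(A, C_n) = n − GKdim E` equals `n − 1`. -/
theorem gkdim_skewGroup_quotient_six_nine_ten
    (k : Type*) [Field k] [IsAlgClosed k] [CharZero k]
    (n : ℕ) (hn : n = 6 ∨ n = 9 ∨ n = 10) :
    gkdim k (Equot k n) (Vgen k n) = 1 ∧
      (n : ℝ) - gkdim k (Equot k n) (Vgen k n) = (n : ℝ) - 1 := by
  have key : gkdim k (Equot k n) (Vgen k n) = 1 := by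
    rcases hn with rfl | rfl | rfl
    · refine gkdim_Equot_eq_one (fun d hd => ?_) (p := 3) (by norm_num) (by norm_num)
        isSeed_seedThree
      have := Nat.le_of_dvd (by norm_num) hd
      interval_cases d <;> omega
    · refine gkdim_Equot_eq_one (fun d hd => ?_) (p := 3) (by norm_num) (by norm_num)
        isSeed_seedThree
      have := Nat.le_of_dvd (by norm_num) hd
      interval_cases d <;> omega
    · refine gkdim_Equot_eq_one (fun d hd => ?_) (p := 5) (by norm_num) (by norm_num)
        isSeed_seedFive
      have := Nat.le_of_dvd (by norm_num) hd
      interval_cases d <;> omega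
  rw [key]
  exact ⟨rfl, rfl⟩
end

section
/- Let φ₂(n) := {k : 0 ≤ k ≤ n−1 and gcd(k,n) = 2^w for some integer w ≥ 0} and Ω₂(n) := {i₀ ∈ ℤ/nℤ : for every odd integer i with 1 ≤ i ≤ n and i ∉ φ₂(n), the class of i₀ − i is invertible in ℤ/nℤ}. Let p₁ and p₂ be two distinct odd primes. (1) If n = p₁ p₂, then Ω₂(n) ≠ ∅. (2) If n = p₁ p₂² n′ or n = 2 p₁ p₂ n′ for some integer n′ ≥ 1, then Ω₂(n) = ∅. -/
namespace NCIS

/-- `φ₂(n)`-membership: `gcd(m, n)` is a power of `2`. -/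
def MemPhi2 (n m : ℕ) : Prop := ∃ w : ℕ, Nat.gcd m n = 2 ^ w

/-- `Ω₂(n)`: the set of `i₀ ∈ ℤ/n` such that for every odd integer `1 ≤ i ≤ n` with
`i ∉ φ₂(n)`, the class of `i₀ − i` is invertible in `ℤ/n`. -/
def Omega2 (n : ℕ) : Set (ZMod n) :=
  {i₀ : ZMod n | ∀ i : ℕ, Odd i → 1 ≤ i → i ≤ n → ¬ MemPhi2 n i →
    IsUnit (i₀ - (i : ZMod n))}

/-- If a prime `p ≠ 2` divides both `m` and `n`, then `gcd(m, n)` is not a power of `2`. -/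
lemma not_memPhi2_of_prime_dvd {n m p : ℕ} (hp : p.Prime) (ho : Odd p) (hm : p ∣ m)
    (hn : p ∣ n) : ¬ MemPhi2 n m := by
  rintro ⟨w, hw⟩
  have h2 : p ∣ 2 := hp.dvd_of_dvd_pow (hw ▸ Nat.dvd_gcd hm hn)
  rw [(Nat.prime_dvd_prime_iff_eq hp Nat.prime_two).1 h2] at ho
  exact absurd ho (by decide)

lemma prime_dvd_of_not_memPhi2 {p q m : ℕ} (hp : p.Prime) (hq : q.Prime)
    (h : ¬ MemPhi2 (p * q) m) : p ∣ m ∨ q ∣ m := by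
  by_contra! hpq
  refine h ⟨0, ?_⟩
  exact Nat.Coprime.mul_right ((hp.coprime_iff_not_dvd.2 hpq.1).symm)
    ((hq.coprime_iff_not_dvd.2 hpq.2).symm)

lemma omega2_eq_empty {p q n : ℕ} (hp : p.Prime) (hq : q.Prime) (hpo : Odd p) (hqo : Odd q)
    (hne : p ≠ q) (hdvd : p * q ∣ n) (hle : 2 * p * q ≤ n) : Omega2 n = ∅ := by
  refine Set.eq_empty_iff_forall_notMem.2 fun i₀ hi₀ => ?_
  have : Fact q.Prime := ⟨hq⟩
  have hqn : q ∣ n := (Dvd.intro_left p rfl).trans hdvd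
  have hcop : Nat.Coprime (2 * p) q :=
    Nat.Coprime.mul_left (Nat.coprime_two_left.2 hqo) ((Nat.coprime_primes hp hq).2 hne)
  let φ : ZMod n →+* ZMod q := ZMod.castHom hqn (ZMod q)
  obtain ⟨i, hip, hiq, hlt⟩ : ∃ i, i ≡ p [MOD 2 * p] ∧ i ≡ (φ i₀).val [MOD q] ∧
      i < 2 * p * q :=
    ⟨_, (Nat.chineseRemainder hcop p (φ i₀).val).2.1,
      (Nat.chineseRemainder hcop p (φ i₀).val).2.2,
      Nat.chineseRemainder_lt_mul hcop _ _ (by have := hp.pos; omega) hq.ne_zero⟩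
  have hodd : Odd i := by
    have h2 : i % 2 = p % 2 := hip.of_mul_right p
    rw [Nat.odd_iff] at hpo ⊢
    omega
  have hpi : p ∣ i := (hip.of_mul_left 2).dvd_iff dvd_rfl |>.2 dvd_rfl
  have hunit := (hi₀ i hodd hodd.pos (hlt.le.trans hle)
    (not_memPhi2_of_prime_dvd hp hpo hpi ((Dvd.intro q rfl).trans hdvd))).map φ
  have hi : (i : ZMod q) = φ i₀ := by
    rw [(ZMod.natCast_eq_natCast_iff _ _ _).2 hiq, ZMod.natCast_zmod_val]
  rw [map_sub, map_natCast, hi, sub_self] at hunit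
  exact not_isUnit_zero hunit

lemma isCoprime_two_mul_add_sub {p q i : ℕ} (hp : p.Prime) (hq : q.Prime) (hpo : Odd p)
    (hqo : Odd q) (hne : p ≠ q) (hi : Odd i) (hle : i ≤ p * q) (hpi : p ∣ i) :
    IsCoprime (2 * (p + q) - i : ℤ) (p * q) := by
  obtain ⟨a, rfl⟩ := hpi
  have hp' := Nat.prime_iff_prime_int.1 hp
  have hq' := Nat.prime_iff_prime_int.1 hq
  have haq : a ≤ q := Nat.le_of_mul_le_mul_left hle hp.pos
  have ha : Odd a := (Nat.odd_mul.1 hi).2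
  have hp2 : ¬ (p : ℤ) ∣ 2 := by
    intro h
    have h := Nat.le_of_dvd two_pos (by exact_mod_cast h : p ∣ 2)
    obtain rfl : p = 2 := le_antisymm h hp.two_le
    exact absurd hpo (by decide)
  have hpq : ¬ (p : ℤ) ∣ q := by
    rwa [Int.natCast_dvd_natCast, Nat.prime_dvd_prime_iff_eq hp hq]
  have hqp : ¬ (q : ℤ) ∣ p := by
    rw [Int.natCast_dvd_natCast, Nat.prime_dvd_prime_iff_eq hq hp]
    exact hne.symm
  refine IsCoprime.mul_right (hp'.coprime_iff_not_dvd.2 fun h => ?_).symm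
    (hq'.coprime_iff_not_dvd.2 fun h => ?_).symm
  · have h2 : (p : ℤ) ∣ 2 * q := by
      have hsub := dvd_sub h (dvd_mul_right (p : ℤ) (2 - a))
      have heq : (2 * (p + q) - (p * a : ℕ) - p * (2 - a) : ℤ) = 2 * q := by
        push_cast
        ring
      rwa [heq] at hsub
    exact (hp'.dvd_or_dvd h2).elim hp2 hpq
  · have h2 : (q : ℤ) ∣ p * (2 - a) := by
      have hsub := dvd_sub h (dvd_mul_right (q : ℤ) 2)
      have heq : (2 * (p + q) - (p * a : ℕ) - q * 2 : ℤ) = p * (2 - a) := by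
        push_cast
        ring
      rwa [heq] at hsub
    obtain ⟨k, hk⟩ := (hq'.dvd_or_dvd h2).resolve_left hqp
    have hq3 := hq.two_le
    obtain ⟨b, rfl⟩ := ha
    obtain ⟨c, rfl⟩ := hqo
    push_cast at hk haq
    have h0 : -1 < k := by
      by_contra! hk0
      nlinarith
    have h1 : k < 1 := by
      by_contra! hk1
      nlinarith
    obtain rfl : k = 0 := by omega
    omega

lemma omega2_mul_nonempty {p q : ℕ} (hp : p.Prime) (hq : q.Prime) (hpo : Odd p)
    (hqo : Odd q) (hne : p ≠ q) : (Omega2 (p * q)).Nonempty := by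
  refine ⟨((2 * (p + q) : ℤ) : ZMod (p * q)), fun i hi _ hle hmem => ?_⟩
  rw [← Int.cast_natCast (R := ZMod (p * q)) i, ← Int.cast_sub, ZMod.coe_int_isUnit_iff_isCoprime,
    isCoprime_comm, Nat.cast_mul]
  rcases prime_dvd_of_not_memPhi2 hp hq hmem with h | h
  · exact isCoprime_two_mul_add_sub hp hq hpo hqo hne hi hle h
  · rw [add_comm, mul_comm (p : ℤ)]
    exact isCoprime_two_mul_add_sub hq hp hqo hpo hne.symm hi (mul_comm p q ▸ hle) h

end NCIS

open NCIS in
/-- Lemma 7.3: let `p₁, p₂` be distinct odd primes.  Then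
(1) `Ω₂(p₁ p₂) ≠ ∅`, and (2) for every `n′ ≥ 1`, `Ω₂(p₁ p₂² n′) = ∅` and
`Ω₂(2 p₁ p₂ n′) = ∅`. -/
theorem omega2_nonempty_or_empty
    (p₁ p₂ : ℕ) (hp₁ : p₁.Prime) (hp₂ : p₂.Prime) (ho₁ : Odd p₁) (ho₂ : Odd p₂)
    (hne : p₁ ≠ p₂) :
    (Omega2 (p₁ * p₂)).Nonempty ∧
      ∀ n' : ℕ, 1 ≤ n' →
        Omega2 (p₁ * p₂ ^ 2 * n') = ∅ ∧ Omega2 (2 * p₁ * p₂ * n') = ∅ := by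
  refine ⟨omega2_mul_nonempty hp₁ hp₂ ho₁ ho₂ hne, fun n' hn => ⟨?_, ?_⟩⟩
  · refine omega2_eq_empty hp₁ hp₂ ho₁ ho₂ hne ⟨p₂ * n', by ring⟩ ?_
    calc 2 * p₁ * p₂ = p₁ * p₂ * 2 * 1 := by ring
      _ ≤ p₁ * p₂ * p₂ * n' := by gcongr; exact hp₂.two_le
      _ = p₁ * p₂ ^ 2 * n' := by ring
  · exact omega2_eq_empty hp₁ hp₂ ho₁ ho₂ hne ⟨2 * n', by ring⟩ (Nat.le_mul_of_pos_right _ hn)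
end

section
/- Let n = 2^a p₁^b p₂^c where p₁ and p₂ are distinct odd primes, both ≥ 7, and a ≥ 0, b, c ≥ 1. Set mop(n) := min(p₁, p₂). Let i₀ be an integer with 0 ≤ i₀ ≤ n−1 and gcd(i₀, n) a power of 2 (i.e., i₀ ∈ φ₂(n)), and let i be an odd integer with 1 ≤ i ≤ n such that gcd(i, n) is not a power of 2 (i.e., i ∉ φ₂(n)). For an integer ξ set i_ξ := i₀ + ξ(i₀ − i). Then there is at most one integer ξ with 0 ≤ ξ ≤ (mop(n) − 3)/2 − 1 such that gcd(2 i_ξ + (i₀ − i), n) is not a power of 2. -/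
namespace NCIS

/-- `φ₂(n)`-membership for integers: `gcd(m, n)` is a power of `2`. -/
def MemPhi2Int (n : ℕ) (m : ℤ) : Prop := ∃ w : ℕ, Int.gcd m (n : ℤ) = 2 ^ w

theorem MemPhi2Int.not_dvd {n p : ℕ} {m : ℤ} (hp : p.Prime) (hodd : Odd p) (hpn : p ∣ n)
    (hm : MemPhi2Int n m) : ¬ (p : ℤ) ∣ m := by
  intro hpm
  obtain ⟨w, hw⟩ := hm
  have hdvd : p ∣ 2 ^ w := hw ▸ Int.dvd_gcd hpm (Int.natCast_dvd_natCast.mpr hpn)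
  have h2 : p = 2 := (Nat.prime_dvd_prime_iff_eq hp Nat.prime_two).mp (hp.dvd_of_dvd_pow hdvd)
  subst h2
  exact absurd hodd (by decide)

theorem dvd_or_dvd_of_not_memPhi2Int {n a b c p₁ p₂ : ℕ} (hp₁ : p₁.Prime) (hp₂ : p₂.Prime)
    (hn : n = 2 ^ a * p₁ ^ b * p₂ ^ c) {m : ℤ} (hm : ¬ MemPhi2Int n m) :
    (p₁ : ℤ) ∣ m ∨ (p₂ : ℤ) ∣ m := by
  rcases Nat.eq_two_pow_or_exists_odd_prime_and_dvd (Int.gcd m n) with h | ⟨q, hq, hqd, hodd⟩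
  · exact absurd h hm
  have hqm : (q : ℤ) ∣ m := (Int.natCast_dvd_natCast.mpr hqd).trans (Int.gcd_dvd_left ..)
  have hqn : q ∣ n :=
    Int.natCast_dvd_natCast.mp ((Int.natCast_dvd_natCast.mpr hqd).trans (Int.gcd_dvd_right ..))
  rw [hn, hq.dvd_mul, hq.dvd_mul] at hqn
  rcases hqn with (h | h) | h
  · have h2 := (Nat.prime_dvd_prime_iff_eq hq Nat.prime_two).mp (hq.dvd_of_dvd_pow h)
    subst h2
    exact absurd hodd (by decide)
  · exact .inl ((Nat.prime_dvd_prime_iff_eq hq hp₁).mp (hq.dvd_of_dvd_pow h) ▸ hqm)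
  · exact .inr ((Nat.prime_dvd_prime_iff_eq hq hp₂).mp (hq.dvd_of_dvd_pow h) ▸ hqm)

/-- Modulo a divisor `p` of `i` the value at `ξ` is `(2 ξ + 3) i₀`. -/
theorem not_dvd_of_dvd {p : ℕ} (hp : p.Prime) {i₀ i ξ : ℤ} (hi₀ : ¬ (p : ℤ) ∣ i₀)
    (hi : (p : ℤ) ∣ i) (hξ0 : 0 ≤ ξ) (hξ : 2 * ξ + 3 < p) :
    ¬ (p : ℤ) ∣ 2 * (i₀ + ξ * (i₀ - i)) + (i₀ - i) := by
  intro h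
  have hmul : (p : ℤ) ∣ (2 * ξ + 3) * i₀ := by
    have hsum := dvd_add h (hi.mul_left (2 * ξ + 1))
    ring_nf at hsum ⊢
    exact hsum
  rcases (Nat.prime_iff_prime_int.mp hp).dvd_or_dvd hmul with h | h
  · have := Int.le_of_dvd (by linarith) h
    linarith
  · exact hi₀ h

theorem eq_of_dvd_of_dvd {q : ℕ} (hq : q.Prime) (hodd : Odd q) {i₀ i ξ₁ ξ₂ : ℤ}
    (hi₀ : ¬ (q : ℤ) ∣ i₀) (hlt : |ξ₁ - ξ₂| < q)
    (h₁ : (q : ℤ) ∣ 2 * (i₀ + ξ₁ * (i₀ - i)) + (i₀ - i))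
    (h₂ : (q : ℤ) ∣ 2 * (i₀ + ξ₂ * (i₀ - i)) + (i₀ - i)) : ξ₁ = ξ₂ := by
  have hqi := Nat.prime_iff_prime_int.mp hq
  have h2 : ¬ (q : ℤ) ∣ 2 := by
    intro h
    have h2 := (Nat.prime_dvd_prime_iff_eq hq Nat.prime_two).mp (by exact_mod_cast h)
    subst h2
    exact absurd hodd (by decide)
  have hd : ¬ (q : ℤ) ∣ i₀ - i := by
    intro hd
    have : (q : ℤ) ∣ 2 * i₀ := by
      have hdiff := dvd_sub h₁ (hd.mul_left (2 * ξ₁ + 1))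
      ring_nf at hdiff ⊢
      exact hdiff
    exact (hqi.dvd_or_dvd this).elim h2 hi₀
  have hmul : (q : ℤ) ∣ 2 * ((ξ₁ - ξ₂) * (i₀ - i)) := by
    have hdiff := dvd_sub h₁ h₂
    ring_nf at hdiff ⊢
    exact hdiff
  have hsub : (q : ℤ) ∣ ξ₁ - ξ₂ :=
    (hqi.dvd_or_dvd ((hqi.dvd_or_dvd hmul).resolve_left h2)).resolve_right hd
  exact sub_eq_zero.mp (Int.eq_zero_of_abs_lt_dvd hsub hlt)

end NCIS

open NCIS in
/-- Lemma 8.2: let `n = 2^a p₁^b p₂^c` with `p₁ ≠ p₂` odd primes `≥ 7`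
and `b, c ≥ 1`; set `mop(n) = min(p₁, p₂)`.  Let `0 ≤ i₀ ≤ n−1` with `gcd(i₀, n)` a power
of `2`, and let `i` be odd with `1 ≤ i ≤ n` and `gcd(i, n)` not a power of `2`.  Writing
`i_ξ = i₀ + ξ(i₀ − i)`, there is at most one integer `ξ` with
`0 ≤ ξ ≤ (mop(n) − 3)/2 − 1` such that `gcd(2 i_ξ + (i₀ − i), n)` is not a power of `2`. -/
theorem at_most_one_bad_xi
    (n a b c p₁ p₂ : ℕ) (hp₁ : p₁.Prime) (hp₂ : p₂.Prime)
    (ho₁ : Odd p₁) (ho₂ : Odd p₂) (hp₁7 : 7 ≤ p₁) (hp₂7 : 7 ≤ p₂) (hne : p₁ ≠ p₂)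
    (hb : 1 ≤ b) (hc : 1 ≤ c) (hn : n = 2 ^ a * p₁ ^ b * p₂ ^ c)
    (i₀ i : ℤ) (hi₀0 : 0 ≤ i₀) (hi₀n : i₀ ≤ (n : ℤ) - 1) (hi₀ : MemPhi2Int n i₀)
    (hiodd : Odd i) (hi1 : 1 ≤ i) (hin : i ≤ (n : ℤ)) (hi : ¬ MemPhi2Int n i) :
    ∀ ξ₁ ξ₂ : ℤ,
      0 ≤ ξ₁ → ξ₁ ≤ ((min p₁ p₂ : ℤ) - 3) / 2 - 1 →
      0 ≤ ξ₂ → ξ₂ ≤ ((min p₁ p₂ : ℤ) - 3) / 2 - 1 →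
      ¬ MemPhi2Int n (2 * (i₀ + ξ₁ * (i₀ - i)) + (i₀ - i)) →
      ¬ MemPhi2Int n (2 * (i₀ + ξ₂ * (i₀ - i)) + (i₀ - i)) →
      ξ₁ = ξ₂ := by
  intro ξ₁ ξ₂ h₁0 h₁ h₂0 h₂ hbad₁ hbad₂
  have hmin₁ : (min p₁ p₂ : ℤ) ≤ p₁ := min_le_left _ _
  have hmin₂ : (min p₁ p₂ : ℤ) ≤ p₂ := min_le_right _ _
  have hi₀p₁ := hi₀.not_dvd hp₁ ho₁
    (hn ▸ ((dvd_pow_self p₁ (by omega)).mul_left _).mul_right _)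
  have hi₀p₂ := hi₀.not_dvd hp₂ ho₂ (hn ▸ (dvd_pow_self p₂ (by omega)).mul_left _)
  have hdvd₁ := dvd_or_dvd_of_not_memPhi2Int hp₁ hp₂ hn hbad₁
  have hdvd₂ := dvd_or_dvd_of_not_memPhi2Int hp₁ hp₂ hn hbad₂
  rcases dvd_or_dvd_of_not_memPhi2Int hp₁ hp₂ hn hi with hpi | hpi
  · exact eq_of_dvd_of_dvd hp₂ ho₂ hi₀p₂ (abs_lt.mpr ⟨by omega, by omega⟩)
      (hdvd₁.resolve_left (not_dvd_of_dvd hp₁ hi₀p₁ hpi h₁0 (by omega)))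
      (hdvd₂.resolve_left (not_dvd_of_dvd hp₁ hi₀p₁ hpi h₂0 (by omega)))
  · exact eq_of_dvd_of_dvd hp₁ ho₁ hi₀p₁ (abs_lt.mpr ⟨by omega, by omega⟩)
      (hdvd₁.resolve_right (not_dvd_of_dvd hp₂ hi₀p₂ hpi h₁0 (by omega)))
      (hdvd₂.resolve_right (not_dvd_of_dvd hp₂ hi₀p₂ hpi h₂0 (by omega)))
end
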